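/- arXiv:2106.12936 — 4 statements merged into one kernel-verified Lean document; each statement's English description precedes it below -/
import Mathlib

section
/- Grant the compatibility condition ζ ≤ √(2⌊K/2⌋)/(4K). There exist constants c=c(K)>0 and ε₁>0 such that for δ≤1/6, ε≤ε₁, L≤1/3 and n·δ²·ε⁴·ζ⁶≥1, the infimum over all estimators θ̌=(p̌,q̌,f̌₀,f̌₁) (measurable functions of (Y₁,…,Yₙ)) of sup over θ∈Θ_L(δ,ε,ζ) of P_θ( max(|p̌−p|, |q̌−q|) > (c/√(n·δ²·ε⁴·ζ⁶))·max(δ, ε·ζ) ) is at least 1/4. -/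
open scoped BigOperators

namespace PaperHMM

/-- Parameter of a two-state HMM with multinomial emissions on `Fin K`. -/
structure Param (K : ℕ) where
  p : ℝ
  q : ℝ
  f0 : Fin K → ℝ
  f1 : Fin K → ℝ

/-- `f` is a probability density with respect to counting measure on `Fin K`. -/
def IsDensity {K : ℕ} (f : Fin K → ℝ) : Prop :=
  (∀ k, 0 ≤ f k) ∧ ∑ k, f k = 1

/-- Validity of HMM parameters: `p, q ∈ (0,1)` and emission densities. -/
def Valid {K : ℕ} (θ : Param K) : Prop :=
  θ.p ∈ Set.Ioo (0 : ℝ) 1 ∧ θ.q ∈ Set.Ioo (0 : ℝ) 1 ∧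
    IsDensity θ.f0 ∧ IsDensity θ.f1

/-- Euclidean norm of a finitely supported real function. -/
noncomputable def enormF {α : Type*} [Fintype α] (g : α → ℝ) : ℝ :=
  Real.sqrt (∑ a, (g a) ^ 2)

/-- Stationary initial distribution of the hidden chain: `P(X₁=0)=q/(p+q)`. -/
noncomputable def initD {K : ℕ} (θ : Param K) : Fin 2 → ℝ :=
  fun a => if a = 0 then θ.q / (θ.p + θ.q) else θ.p / (θ.p + θ.q)

/-- Transition matrix `Q = [[1-p, p], [q, 1-q]]` of the hidden chain. -/
noncomputable def transP {K : ℕ} (θ : Param K) : Fin 2 → Fin 2 → ℝ :=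
  fun a b =>
    if a = 0 then (if b = 0 then 1 - θ.p else θ.p)
    else (if b = 0 then θ.q else 1 - θ.q)

/-- Emission densities indexed by the hidden state. -/
def emit {K : ℕ} (θ : Param K) : Fin 2 → Fin K → ℝ :=
  fun a => if a = 0 then θ.f0 else θ.f1

/-- The probability mass function `p_θ^{(n)}` of the first `n` observations
`(Y₁,…,Yₙ)`:  `∑_{x ∈ {0,1}ⁿ} P(X₁=x₁) ∏_{i<n} Q_{x_i,x_{i+1}} ∏_{i≤n} f_{x_i}(y_i)`. -/
noncomputable def pLaw {K : ℕ} (θ : Param K) (n : ℕ) (y : Fin n → Fin K) : ℝ :=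
  ∑ x : Fin n → Fin 2,
    (∏ i : Fin n,
        (if (i : ℕ) = 0 then initD θ (x i)
          else transP θ (x ⟨(i : ℕ) - 1, lt_of_le_of_lt (Nat.sub_le _ _) i.isLt⟩) (x i)))
      * ∏ i : Fin n, emit θ (x i) (y i)

open Classical in
/-- Probability under `P_θ` that `(Y₁,…,Yₙ)` lies in the event `E`. -/
noncomputable def probOf {K : ℕ} (θ : Param K) (n : ℕ)
    (E : (Fin n → Fin K) → Prop) : ℝ :=
  ∑ y : Fin n → Fin K, if E y then pLaw θ n y else 0

/-- The parameter class `Θ(δ,ε,ζ)`. -/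
def ThetaSet (K : ℕ) (δ ε ζ : ℝ) : Set (Param K) :=
  {θ | Valid θ ∧ δ ≤ θ.p ∧ δ ≤ θ.q ∧ ε ≤ |1 - θ.p - θ.q| ∧
    ζ ≤ enormF (fun k => θ.f0 k - θ.f1 k)}

/-- The parameter class `Θ_L(δ,ε,ζ)`. -/
def ThetaL (K : ℕ) (L δ ε ζ : ℝ) : Set (Param K) :=
  ThetaSet K δ ε ζ ∩ {θ | L ≤ 1 - |1 - θ.p - θ.q|}

/-- The reparametrised pair `(φ, ψ)`: scalar parameters `φ = (φ₁,φ₂,φ₃)` and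
vector parameters `ψ = (ψ₁, ψ₂)`. -/
abbrev PP (K : ℕ) := (ℝ × ℝ × ℝ) × ((Fin K → ℝ) × (Fin K → ℝ))

/-- `φ(θ) = ((q-p)/(p+q), 1-p-q, ‖f₀-f₁‖)`. -/
noncomputable def phiOf {K : ℕ} (θ : Param K) : ℝ × ℝ × ℝ :=
  ((θ.q - θ.p) / (θ.p + θ.q), 1 - θ.p - θ.q,
    enormF (fun k => θ.f0 k - θ.f1 k))

/-- `ψ(θ) = ((q f₀ + p f₁)/(p+q), (f₀-f₁)/‖f₀-f₁‖)`. -/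
noncomputable def psiOf {K : ℕ} (θ : Param K) : (Fin K → ℝ) × (Fin K → ℝ) :=
  (fun k => (θ.q * θ.f0 k + θ.p * θ.f1 k) / (θ.p + θ.q),
    fun k => (θ.f0 k - θ.f1 k) / enormF (fun j => θ.f0 j - θ.f1 j))

/-- The map `θ ↦ (φ(θ), ψ(θ))`. -/
noncomputable def pack {K : ℕ} (θ : Param K) : PP K := (phiOf θ, psiOf θ)

/-- The inverse parametrisation `θ(φ,ψ)`:
`p = ½(1-φ₂)(1-φ₁)`, `q = ½(1-φ₂)(1+φ₁)`,
`f₀ = ψ₁ - ½φ₁φ₃ψ₂ + ½φ₃ψ₂`, `f₁ = ψ₁ - ½φ₁φ₃ψ₂ - ½φ₃ψ₂`. -/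
noncomputable def unpack {K : ℕ} (π : PP K) : Param K where
  p := (1 - π.1.2.1) * (1 - π.1.1) / 2
  q := (1 - π.1.2.1) * (1 + π.1.1) / 2
  f0 := fun k => π.2.1 k - π.1.1 * π.1.2.2 * π.2.2 k / 2 + π.1.2.2 * π.2.2 k / 2
  f1 := fun k => π.2.1 k - π.1.1 * π.1.2.2 * π.2.2 k / 2 - π.1.2.2 * π.2.2 k / 2

/-- `Φ(δ,ε,ζ)`. -/
def PhiSet (K : ℕ) (δ ε ζ : ℝ) : Set (PP K) := pack '' ThetaSet K δ ε ζ

/-- `Φ_L(δ,ε,ζ)`. -/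
def PhiL (K : ℕ) (L δ ε ζ : ℝ) : Set (PP K) := pack '' ThetaL K L δ ε ζ

/-- `⋃_{δ,ε,ζ} Φ(δ,ε,ζ)`. -/
def PhiAll (K : ℕ) : Set (PP K) :=
  ⋃ (δ ∈ Set.Ioo (0 : ℝ) 1) (ε ∈ Set.Ioo (0 : ℝ) 1) (ζ ∈ Set.Ioi (0 : ℝ)),
    PhiSet K δ ε ζ

/-- `r(φ) = ¼ (1-φ₁²) φ₂ φ₃²`. -/
noncomputable def rfun (φ : ℝ × ℝ × ℝ) : ℝ :=
  (1 - φ.1 ^ 2) * φ.2.1 * φ.2.2 ^ 2 / 4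

/-- `m(φ) = (r(φ), φ₂ r(φ), φ₁ φ₂ φ₃ r(φ))`. -/
noncomputable def mvec (φ : ℝ × ℝ × ℝ) : ℝ × ℝ × ℝ :=
  (rfun φ, φ.2.1 * rfun φ, φ.1 * φ.2.1 * φ.2.2 * rfun φ)

/-- Sign function with the convention `sgn 0 = +1`. -/
noncomputable def sgn (t : ℝ) : ℝ := if t < 0 then -1 else 1

/-- The statistical distance `ρ((φ,ψ);(φ̃,ψ̃))`. -/
noncomputable def rho {K : ℕ} (π π' : PP K) : ℝ :=
  max (max (max (max
    |(mvec π.1).1 - (mvec π'.1).1|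
    |(mvec π.1).2.1 - (mvec π'.1).2.1|)
    |(mvec π.1).2.2 - sgn (∑ k, π.2.2 k * π'.2.2 k) * (mvec π'.1).2.2|)
    (enormF fun k => π.2.1 k - π'.2.1 k))
    ((max |(mvec π.1).1| |(mvec π'.1).1|) *
      enormF fun k => π.2.2 k - sgn (∑ j, π.2.2 j * π'.2.2 j) * π'.2.2 k)

/-- `p^{(3)}_{φ,ψ} = p^{(3)}_{θ(φ,ψ)}`, the law of three consecutive observations. -/
noncomputable def p3 {K : ℕ} (π : PP K) : (Fin 3 → Fin K) → ℝ :=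
  pLaw (unpack π) 3

/-- The empirical estimator `p̂ₙ^{(3)}(a,b,c) = n⁻¹ ∑_{i=1}^{n-2} 1{Yᵢ=a, Y_{i+1}=b, Y_{i+2}=c}`. -/
noncomputable def empP3 {K : ℕ} (n : ℕ) (y : Fin n → Fin K)
    (v : Fin 3 → Fin K) : ℝ :=
  (n : ℝ)⁻¹ * ∑ i : Fin n,
    if h : (i : ℕ) + 2 < n then
      (if y i = v 0 ∧ y ⟨(i : ℕ) + 1, by omega⟩ = v 1 ∧ y ⟨(i : ℕ) + 2, h⟩ = v 2
        then 1 else 0)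
    else 0

/-- Kullback–Leibler divergence `K(P;Q) = ∑_y P(y) log(P(y)/Q(y))` between
probability mass functions on `(Fin K)ⁿ`. -/
noncomputable def klDiv {K : ℕ} (n : ℕ) (P Q : (Fin n → Fin K) → ℝ) : ℝ :=
  ∑ y : Fin n → Fin K, P y * Real.log (P y / Q y)



/-- The sum over tuples of length `n+1` as an iterated sum. -/
lemma sum_snoc {α : Type*} [Fintype α] (n : ℕ) (F : (Fin (n + 1) → α) → ℝ) :
    ∑ y, F y = ∑ y' : Fin n → α, ∑ k : α, F (Fin.snoc (α := fun _ => α) y' k) := by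
  rw [← Fintype.sum_equiv (Fin.snocEquiv (fun _ : Fin (n + 1) => α))
    (fun z => F (Fin.snoc (α := fun _ => α) z.2 z.1)) F (fun z => rfl)]
  rw [Fintype.sum_prod_type, Finset.sum_comm]

/-- Joint weight of hidden states and observations. -/
noncomputable def Wt {K : ℕ} (θ : Param K) (n : ℕ) (x : Fin n → Fin 2) (y : Fin n → Fin K) : ℝ :=
  (∏ i : Fin n,
        (if (i : ℕ) = 0 then initD θ (x i)
          else transP θ (x ⟨(i : ℕ) - 1, lt_of_le_of_lt (Nat.sub_le _ _) i.isLt⟩) (x i)))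
      * ∏ i : Fin n, emit θ (x i) (y i)

noncomputable def Fh {K : ℕ} (θ : Param K) (n : ℕ) (y : Fin (n + 1) → Fin K) (h : Fin 2 → ℝ) : ℝ :=
  ∑ x : Fin (n + 1) → Fin 2, Wt θ (n + 1) x y * h (x (Fin.last n))

lemma pLaw_eq_Fh {K : ℕ} (θ : Param K) (n : ℕ) (y : Fin (n + 1) → Fin K) :
    pLaw θ (n + 1) y = Fh θ n y (fun _ => 1) := by
  simp [pLaw, Fh, Wt]

lemma Fh_zero {K : ℕ} (θ : Param K) (y : Fin 1 → Fin K) (h : Fin 2 → ℝ) :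
    Fh θ 0 y h = ∑ a, initD θ a * emit θ a (y 0) * h a := by
  unfold Fh Wt
  rw [Fintype.sum_equiv (Equiv.funUnique (Fin 1) (Fin 2)) _
    (fun a => initD θ a * emit θ a (y 0) * h a)]
  intro x
  simp

lemma Wt_snoc {K : ℕ} (θ : Param K) (n : ℕ) (x : Fin (n + 1) → Fin 2) (b : Fin 2)
    (y : Fin (n + 2) → Fin K) :
    Wt θ (n + 2) (Fin.snoc (α := fun _ => Fin 2) x b) y =
      Wt θ (n + 1) x (fun i => y i.castSucc) *
        (transP θ (x (Fin.last n)) b * emit θ b (y (Fin.last (n + 1)))) := by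
  unfold Wt
  rw [Fin.prod_univ_castSucc (n := n + 1), Fin.prod_univ_castSucc (n := n + 1)]
  have h1 : ∀ i : Fin (n + 1),
      (Fin.snoc (α := fun _ => Fin 2) x b : Fin (n + 2) → Fin 2)
        ⟨((i.castSucc : Fin (n + 2)) : ℕ) - 1,
          lt_of_le_of_lt (Nat.sub_le _ _) i.castSucc.isLt⟩ =
      x ⟨(i : ℕ) - 1, lt_of_le_of_lt (Nat.sub_le _ _) i.isLt⟩ := by
    intro i
    have : (⟨((i.castSucc : Fin (n + 2)) : ℕ) - 1,
          lt_of_le_of_lt (Nat.sub_le _ _) i.castSucc.isLt⟩ : Fin (n + 2)) =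
        Fin.castSucc ⟨(i : ℕ) - 1, lt_of_le_of_lt (Nat.sub_le _ _) i.isLt⟩ := by
      ext; simp
    rw [this, Fin.snoc_castSucc]
  have h2 : (Fin.snoc (α := fun _ => Fin 2) x b : Fin (n + 2) → Fin 2)
        ⟨((Fin.last (n + 1) : Fin (n + 2)) : ℕ) - 1,
          lt_of_le_of_lt (Nat.sub_le _ _) (Fin.last (n + 1)).isLt⟩ = x (Fin.last n) := by
    have : (⟨((Fin.last (n + 1) : Fin (n + 2)) : ℕ) - 1,
          lt_of_le_of_lt (Nat.sub_le _ _) (Fin.last (n + 1)).isLt⟩ : Fin (n + 2)) =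
        Fin.castSucc (Fin.last n) := by
      ext; simp
    rw [this, Fin.snoc_castSucc]
  simp only [h1, h2]
  simp only [Fin.snoc_castSucc, Fin.snoc_last, Fin.val_castSucc, Fin.val_last]
  rw [if_neg (Nat.succ_ne_zero n)]
  ring

lemma Fh_succ {K : ℕ} (θ : Param K) (n : ℕ) (y : Fin (n + 2) → Fin K) (h : Fin 2 → ℝ) :
    Fh θ (n + 1) y h = Fh θ n (fun i => y i.castSucc)
      (fun a => ∑ b, transP θ a b * emit θ b (y (Fin.last (n + 1))) * h b) := by
  unfold Fh
  rw [sum_snoc]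
  refine Finset.sum_congr rfl fun x _ => ?_
  rw [Finset.mul_sum]
  refine Finset.sum_congr rfl fun b _ => ?_
  rw [Wt_snoc, Fin.snoc_last]
  ring

lemma Fh_lin {K : ℕ} (θ : Param K) (n : ℕ) (y : Fin (n + 1) → Fin K) (h g : Fin 2 → ℝ) (a b : ℝ) :
    Fh θ n y (fun x => a * h x + b * g x) = a * Fh θ n y h + b * Fh θ n y g := by
  unfold Fh
  rw [Finset.mul_sum, Finset.mul_sum, ← Finset.sum_add_distrib]
  refine Finset.sum_congr rfl fun x _ => ?_
  ring

/-- The concrete parameter. -/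
noncomputable def mkP (K : ℕ) (u : Fin K → ℝ) (lam pi eta : ℝ) : Param K where
  p := (1 - lam) * pi
  q := (1 - lam) * (1 - pi)
  f0 := fun k => (1 + eta * pi * u k) / K
  f1 := fun k => (1 - eta * (1 - pi) * u k) / K

/-- one-step filter map -/
noncomputable def fstep (rho lam om v b : ℝ) : ℝ := (rho * v + (lam - om * v) * b) / (1 + v * b)

/-- predictive filter -/
noncomputable def filt {K : ℕ} (u : Fin K → ℝ) (rho lam om : ℝ) : (n : ℕ) → (Fin n → Fin K) → ℝ
  | 0, _ => 0
  | n + 1, y => fstep rho lam om (u (y (Fin.last n))) (filt u rho lam om n (fun i => y i.castSucc))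

/-- law in product form -/
noncomputable def law {K : ℕ} (u : Fin K → ℝ) (rho lam om : ℝ) : (n : ℕ) → (Fin n → Fin K) → ℝ
  | 0, _ => 1
  | n + 1, y => law u rho lam om n (fun i => y i.castSucc) *
      ((1 + u (y (Fin.last n)) * filt u rho lam om n (fun i => y i.castSucc)) / K)

lemma fstep_bound {rho lam om v b : ℝ} (hv : |v| ≤ 1) (hr : |rho| ≤ 1 / 16)
    (hk : |lam - om * v| ≤ 1 / 4) (hb : |b| ≤ 2 * |rho|) :
    |v * b| ≤ 1 / 8 ∧ |fstep rho lam om v b| ≤ 2 * |rho| := by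
  have h1 : |v * b| ≤ 1 / 8 := by
    rw [abs_mul]; nlinarith [abs_nonneg v, abs_nonneg b]
  refine ⟨h1, ?_⟩
  have h2 : 7 / 8 ≤ 1 + v * b := by have := (abs_le.1 h1).1; linarith
  unfold fstep
  rw [abs_div, abs_of_pos (show 0 < 1 + v * b by linarith), div_le_iff₀ (by linarith)]
  have h3 : |rho * v + (lam - om * v) * b| ≤ |rho| * |v| + |lam - om * v| * |b| := by
    rw [← abs_mul, ← abs_mul]; exact abs_add_le _ _
  nlinarith [abs_nonneg v, abs_nonneg b, abs_nonneg rho, abs_nonneg (lam - om * v)]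

lemma fstep_diff {rho lam om lam' om' v b b' E : ℝ} (hv : |v| ≤ 1) (hr : |rho| ≤ 1 / 16)
    (hk : |lam - om * v| ≤ 1 / 4) (hk' : |lam' - om' * v| ≤ 1 / 4)
    (hE : |(lam - om * v) - (lam' - om' * v)| ≤ E)
    (hb : |b| ≤ 2 * |rho|) (hb' : |b'| ≤ 2 * |rho|) (hd : |b - b'| ≤ 8 * |rho| * E) :
    |fstep rho lam om v b - fstep rho lam' om' v b'| ≤ 8 * |rho| * E := by
  obtain ⟨h1, _⟩ := fstep_bound hv hr hk hb
  obtain ⟨h1', _⟩ := fstep_bound hv hr hk' hb'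
  have h2 : 7 / 8 ≤ 1 + v * b := by have := (abs_le.1 h1).1; linarith
  have h2' : 7 / 8 ≤ 1 + v * b' := by have := (abs_le.1 h1').1; linarith
  unfold fstep
  generalize lam - om * v = k at *
  generalize lam' - om' * v = k' at *
  have hE0 : 0 ≤ E := (abs_nonneg _).trans hE
  have e : (rho * v + k * b) / (1 + v * b) - (rho * v + k' * b') / (1 + v * b') =
      ((k - k') * (b * (1 + v * b')) + (k' - rho * (v * v)) * (b - b')) /
        ((1 + v * b) * (1 + v * b')) := by
    have : 1 + v * b ≠ 0 := by linarith
    have : 1 + v * b' ≠ 0 := by linarith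
    field_simp
    ring
  have hpos : 49 / 64 ≤ (1 + v * b) * (1 + v * b') := by nlinarith
  rw [e, abs_div, abs_of_pos (show 0 < (1 + v * b) * (1 + v * b') by linarith),
    div_le_iff₀ (by linarith)]
  have a1 : |(k - k') * (b * (1 + v * b'))| ≤ E * (2 * |rho| * (9 / 8)) := by
    rw [abs_mul, abs_mul]
    have : |1 + v * b'| ≤ 9 / 8 := by
      rw [abs_of_pos (by linarith)]; have := (abs_le.1 h1').2; linarith
    gcongr
  have a2 : |(k' - rho * (v * v)) * (b - b')| ≤ (5 / 16) * (8 * |rho| * E) := by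
    rw [abs_mul]
    have : |k' - rho * (v * v)| ≤ 5 / 16 := by
      have h3 : |rho * (v * v)| ≤ 1 / 16 := by
        rw [abs_mul, abs_mul]
        calc |rho| * (|v| * |v|) ≤ (1 / 16) * (1 * 1) := by gcongr
          _ = 1 / 16 := by norm_num
      have := abs_sub k' (rho * (v * v))
      linarith
    gcongr
  have a3 := abs_add_le ((k - k') * (b * (1 + v * b'))) ((k' - rho * (v * v)) * (b - b'))
  have hRE : 0 ≤ |rho| * E := by positivity
  nlinarith

/-- Good filter parameters. -/
def Good {K : ℕ} (u : Fin K → ℝ) (rho lam om : ℝ) : Prop :=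
  (∀ k, |u k| ≤ 1) ∧ |rho| ≤ 1 / 16 ∧ ∀ k, |lam - om * u k| ≤ 1 / 4

lemma filt_bound {K : ℕ} {u : Fin K → ℝ} {rho lam om : ℝ} (h : Good u rho lam om) :
    ∀ (n : ℕ) (y : Fin n → Fin K), |filt u rho lam om n y| ≤ 2 * |rho| := by
  intro n
  induction n with
  | zero => intro y; simp [filt]
  | succ n ih => intro y; exact (fstep_bound (h.1 _) h.2.1 (h.2.2 _) (ih _)).2

lemma filt_mul {K : ℕ} {u : Fin K → ℝ} {rho lam om : ℝ} (h : Good u rho lam om)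
    (n : ℕ) (y : Fin n → Fin K) (k : Fin K) :
    7 / 8 ≤ 1 + u k * filt u rho lam om n y := by
  have := (abs_le.1 (fstep_bound (h.1 k) h.2.1 (h.2.2 k) (filt_bound h n y)).1).1
  linarith

lemma filt_diff {K : ℕ} {u : Fin K → ℝ} {rho lam om lam' om' E : ℝ}
    (h : Good u rho lam om) (h' : Good u rho lam' om') (hE0 : 0 ≤ E)
    (hE : ∀ k, |(lam - om * u k) - (lam' - om' * u k)| ≤ E) :
    ∀ (n : ℕ) (y : Fin n → Fin K),
      |filt u rho lam om n y - filt u rho lam' om' n y| ≤ 8 * |rho| * E := by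
  intro n
  induction n with
  | zero => intro y; simp [filt]; positivity
  | succ n ih =>
    intro y
    exact fstep_diff (h.1 _) h.2.1 (h.2.2 _) (h'.2.2 _) (hE _) (filt_bound h _ _)
      (filt_bound h' _ _) (ih _)

lemma law_pos {K : ℕ} (hK : 0 < K) {u : Fin K → ℝ} {rho lam om : ℝ} (h : Good u rho lam om) :
    ∀ (n : ℕ) (y : Fin n → Fin K), 0 < law u rho lam om n y := by
  intro n
  induction n with
  | zero => intro y; simp [law]
  | succ n ih =>
    intro y
    have := filt_mul h n (fun i => y i.castSucc) (y (Fin.last n))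
    have hK' : (0 : ℝ) < K := by exact_mod_cast hK
    exact mul_pos (ih _) (div_pos (by linarith) hK')

lemma law_sum {K : ℕ} (hK : 0 < K) {u : Fin K → ℝ} (hu : ∑ k, u k = 0) (rho lam om : ℝ) :
    ∀ (n : ℕ), ∑ y, law u rho lam om n y = 1 := by
  intro n
  have hK' : (K : ℝ) ≠ 0 := by exact_mod_cast hK.ne'
  induction n with
  | zero => simp [law]
  | succ n ih =>
    rw [sum_snoc, ← ih]
    refine Finset.sum_congr rfl fun y _ => ?_
    simp only [law, Fin.snoc_castSucc, Fin.snoc_last]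
    rw [← Finset.mul_sum, ← Finset.sum_div, Finset.sum_add_distrib, ← Finset.sum_mul, hu]
    simp [hK']

lemma law_chi {K : ℕ} (hK : 0 < K) {u : Fin K → ℝ} (hu : ∑ k, u k = 0)
    {rho lam om lam' om' E : ℝ}
    (h : Good u rho lam om) (h' : Good u rho lam' om') (hE0 : 0 ≤ E)
    (hE : ∀ k, |(lam - om * u k) - (lam' - om' * u k)| ≤ E) :
    ∀ n : ℕ, ∑ y, law u rho lam om n y ^ 2 / law u rho lam' om' n y ≤
      (1 + 2 * (8 * |rho| * E) ^ 2) ^ n := by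
  intro n
  have hK' : (0 : ℝ) < K := by exact_mod_cast hK
  induction n with
  | zero => simp [law]
  | succ n ih =>
    rw [sum_snoc, pow_succ]
    refine le_trans ?_ (mul_le_mul_of_nonneg_right ih (by positivity))
    rw [Finset.sum_mul]
    refine Finset.sum_le_sum fun y _ => ?_
    simp only [law, Fin.snoc_castSucc, Fin.snoc_last]
    have hP := law_pos hK h n y
    have hQ := law_pos hK h' n y
    have hd := filt_diff h h' hE0 hE n y
    have hm := filt_mul h' n y
    generalize law u rho lam om n y = P at *
    generalize law u rho lam' om' n y = Q at *
    generalize filt u rho lam om n y = b at *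
    generalize filt u rho lam' om' n y = b' at *
    have key : ∀ k, (P * ((1 + u k * b) / K)) ^ 2 / (Q * ((1 + u k * b') / K)) ≤
        P ^ 2 / Q * ((1 + 2 * u k * b - u k * b' + 2 * (8 * |rho| * E) ^ 2) / K) := by
      intro k
      have hk := hm k
      have e : (P * ((1 + u k * b) / K)) ^ 2 / (Q * ((1 + u k * b') / K)) =
          P ^ 2 / Q * (((1 + u k * b) ^ 2 / (1 + u k * b')) / K) := by
        have : 1 + u k * b' ≠ 0 := by linarith
        field_simp
      rw [e]
      have : (1 + u k * b) ^ 2 / (1 + u k * b') ≤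
          1 + 2 * u k * b - u k * b' + 2 * (8 * |rho| * E) ^ 2 := by
        rw [div_le_iff₀ (by linarith)]
        have s1 : (u k * (b - b')) ^ 2 ≤ (8 * |rho| * E) ^ 2 := by
          rw [← sq_abs, abs_mul]
          have : |u k| * |b - b'| ≤ 1 * (8 * |rho| * E) :=
            mul_le_mul (h.1 k) hd (abs_nonneg _) zero_le_one
          rw [one_mul] at this
          gcongr
        nlinarith [sq_nonneg (8 * |rho| * E)]
      gcongr
    refine (Finset.sum_le_sum fun k _ => key k).trans ?_
    rw [← Finset.mul_sum, ← Finset.sum_div]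
    have : ∑ k, (1 + 2 * u k * b - u k * b' + 2 * (8 * |rho| * E) ^ 2) =
        K * (1 + 2 * (8 * |rho| * E) ^ 2) := by
      have e2 : ∀ k, (1 + 2 * u k * b - u k * b' + 2 * (8 * |rho| * E) ^ 2) =
        u k * (2 * b - b') + (1 + 2 * (8 * |rho| * E) ^ 2) := fun k => by ring
      simp only [e2]
      rw [Finset.sum_add_distrib, ← Finset.sum_mul, hu]
      simp
      ring
    rw [this, mul_div_cancel_left₀ _ hK'.ne']

/-- centered hidden state -/
noncomputable def sfun (pi : ℝ) : Fin 2 → ℝ := fun a => if a = 0 then pi else -(1 - pi)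

lemma Fh_law {K : ℕ} (hK : 0 < K) {u : Fin K → ℝ} {lam pi eta : ℝ} (hlam : lam < 1)
    (h : Good u (lam * eta ^ 2 * (pi * (1 - pi))) lam (lam * eta * (1 - 2 * pi))) :
    ∀ (n : ℕ) (y : Fin (n + 1) → Fin K),
      Fh (mkP K u lam pi eta) n y (fun _ => 1) =
        law u (lam * eta ^ 2 * (pi * (1 - pi))) lam (lam * eta * (1 - 2 * pi)) (n + 1) y ∧
      lam * eta * Fh (mkP K u lam pi eta) n y (sfun pi) =
        law u (lam * eta ^ 2 * (pi * (1 - pi))) lam (lam * eta * (1 - 2 * pi)) (n + 1) y *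
        filt u (lam * eta ^ 2 * (pi * (1 - pi))) lam (lam * eta * (1 - 2 * pi)) (n + 1) y := by
  have hK' : (K : ℝ) ≠ 0 := by exact_mod_cast hK.ne'
  have hl : 1 - lam ≠ 0 := by linarith
  have hs : (1 - lam) * pi + (1 - lam) * (1 - pi) = 1 - lam := by ring
  intro n
  induction n with
  | zero =>
    intro y
    rw [Fh_zero, Fh_zero]
    simp only [Fin.sum_univ_two, initD, emit, sfun, mkP, hs, law, filt, fstep]
    norm_num
    rw [mul_div_cancel_left₀ _ hl, mul_div_cancel_left₀ _ hl]
    constructor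
    · field_simp; ring
    · field_simp; ring
  | succ n ih =>
    intro y
    obtain ⟨i1, i2⟩ := ih (fun i => y i.castSucc)
    have hm := filt_mul h (n + 1) (fun i => y i.castSucc) (y (Fin.last (n + 1)))
    have e1 : (fun a => ∑ b, transP (mkP K u lam pi eta) a b *
        emit (mkP K u lam pi eta) b (y (Fin.last (n + 1))) * (1 : ℝ)) =
        fun a => (1 / K) * (1 : ℝ) + (u (y (Fin.last (n + 1))) * eta * lam / K) * sfun pi a := by
      funext a
      fin_cases a <;> simp [transP, emit, sfun, mkP] <;> field_simp <;> ring
    have e2 : (fun a => ∑ b, transP (mkP K u lam pi eta) a b *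
        emit (mkP K u lam pi eta) b (y (Fin.last (n + 1))) * sfun pi b) =
        fun a => (u (y (Fin.last (n + 1))) * eta * (pi * (1 - pi)) / K) * (1 : ℝ) +
          ((lam - u (y (Fin.last (n + 1))) * eta * (1 - 2 * pi) * lam) / K) * sfun pi a := by
      funext a
      fin_cases a <;> simp [transP, emit, sfun, mkP] <;> field_simp <;> ring
    rw [Fh_succ, Fh_succ, e1, e2, Fh_lin, Fh_lin, i1]
    set A := law u (lam * eta ^ 2 * (pi * (1 - pi))) lam (lam * eta * (1 - 2 * pi)) (n + 1)
      (fun i => y i.castSucc) with hA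
    set b := filt u (lam * eta ^ 2 * (pi * (1 - pi))) lam (lam * eta * (1 - 2 * pi)) (n + 1)
      (fun i => y i.castSucc) with hb
    set S := Fh (mkP K u lam pi eta) n (fun i => y i.castSucc) (sfun pi)
    have l2 : law u (lam * eta ^ 2 * (pi * (1 - pi))) lam (lam * eta * (1 - 2 * pi)) (n + 1 + 1) y
       = A * ((1 + u (y (Fin.last (n + 1))) * b) / K) := rfl
    have f2 : filt u (lam * eta ^ 2 * (pi * (1 - pi))) lam (lam * eta * (1 - 2 * pi)) (n + 1 + 1) y
       = fstep (lam * eta ^ 2 * (pi * (1 - pi))) lam (lam * eta * (1 - 2 * pi))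
          (u (y (Fin.last (n + 1)))) b := rfl
    rw [l2, f2]
    generalize u (y (Fin.last (n + 1))) = v at *
    have hne : 1 + v * b ≠ 0 := by linarith
    constructor
    · have : 1 / (K : ℝ) * A + v * eta * lam / K * S = (A + v * (lam * eta * S)) / K := by
        field_simp
      rw [this, i2]; field_simp
    · have : lam * eta * (v * eta * (pi * (1 - pi)) / K * A +
          (lam - v * eta * (1 - 2 * pi) * lam) / K * S) =
          (lam * eta ^ 2 * (pi * (1 - pi)) * v * A +
          (lam - lam * eta * (1 - 2 * pi) * v) * (lam * eta * S)) / K := by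
        field_simp
      rw [this, i2]
      unfold fstep
      field_simp

lemma pLaw_law {K : ℕ} (hK : 0 < K) {u : Fin K → ℝ} {lam pi eta : ℝ} (hlam : lam < 1)
    (h : Good u (lam * eta ^ 2 * (pi * (1 - pi))) lam (lam * eta * (1 - 2 * pi)))
    (n : ℕ) (y : Fin n → Fin K) :
    pLaw (mkP K u lam pi eta) n y =
        law u (lam * eta ^ 2 * (pi * (1 - pi))) lam (lam * eta * (1 - 2 * pi)) n y := by
  cases n with
  | zero => simp [pLaw, law]
  | succ n => rw [pLaw_eq_Fh]; exact (Fh_law hK hlam h n y).1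


/-- balanced sign vector -/
def uvec (K : ℕ) : Fin K → ℝ := fun k =>
  if (k : ℕ) < K / 2 then 1 else if (k : ℕ) < 2 * (K / 2) then -1 else 0

lemma sum_balanced (K : ℕ) (F : ℝ → ℝ) (h0 : F 0 = 0) :
    ∑ k, F (uvec K k) = ((K / 2 : ℕ) : ℝ) * F 1 + ((K / 2 : ℕ) : ℝ) * F (-1) := by
  unfold uvec
  rw [Fin.sum_univ_eq_sum_range (fun k => F (if k < K / 2 then 1 else
    if k < 2 * (K / 2) then -1 else 0))]
  have hh : ∑ k ∈ Finset.range (K / 2 + K / 2), F (if k < K / 2 then 1 else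
      if k < 2 * (K / 2) then -1 else 0) =
      ((K / 2 : ℕ) : ℝ) * F 1 + ((K / 2 : ℕ) : ℝ) * F (-1) := by
    rw [Finset.sum_range_add]
    congr 1
    · rw [Finset.sum_congr rfl (g := fun _ => F 1)]
      · simp
      · intro k hk
        rw [if_pos (Finset.mem_range.1 hk)]
    · rw [Finset.sum_congr rfl (g := fun _ => F (-1))]
      · simp
      · intro k hk
        have := Finset.mem_range.1 hk
        rw [if_neg (by omega), if_pos (by omega)]
  rcases Nat.mod_two_eq_zero_or_one K with h | h
  · have e : Finset.range K = Finset.range (K / 2 + K / 2) := by congr 1; omega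
    rw [e, hh]
  · have e : Finset.range K = Finset.range (K / 2 + K / 2 + 1) := by congr 1; omega
    rw [e, Finset.sum_range_succ, hh, if_neg (by omega), if_neg (by omega), h0, add_zero]

lemma uvec_sum (K : ℕ) : ∑ k, uvec K k = 0 := by
  rw [sum_balanced K (fun x => x) rfl]; ring

lemma uvec_sq (K : ℕ) : ∑ k, uvec K k ^ 2 = 2 * ((K / 2 : ℕ) : ℝ) := by
  rw [sum_balanced K (fun x => x ^ 2) (by norm_num)]; ring

lemma uvec_abs (K : ℕ) (k : Fin K) : |uvec K k| ≤ 1 := by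
  unfold uvec; split_ifs <;> simp

lemma good_mk {K : ℕ} {lam pi eta : ℝ} (hl0 : 0 ≤ lam) (hl : lam ≤ 1 / 6) (hp0 : 0 ≤ pi)
    (hp : pi ≤ 2 / 3) (he0 : 0 ≤ eta) (he : eta ≤ 1 / 2) :
    Good (uvec K) (lam * eta ^ 2 * (pi * (1 - pi))) lam (lam * eta * (1 - 2 * pi)) := by
  have hpp : 0 ≤ pi * (1 - pi) := mul_nonneg hp0 (by linarith)
  refine ⟨uvec_abs K, ?_, fun k => ?_⟩
  · rw [abs_of_nonneg (by positivity)]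
    calc lam * eta ^ 2 * (pi * (1 - pi)) ≤ (1 / 6) * (1 / 2) ^ 2 * (1 / 4) := by
          gcongr
          nlinarith [sq_nonneg (pi - 1 / 2)]
      _ ≤ 1 / 16 := by norm_num
  · have h1 : |lam * eta * (1 - 2 * pi) * uvec K k| ≤ (1 / 6) * (1 / 2) * 1 * 1 := by
      rw [abs_mul, abs_mul, abs_of_nonneg (show 0 ≤ lam * eta by positivity)]
      have : |1 - 2 * pi| ≤ 1 := abs_le.2 ⟨by linarith, by linarith⟩
      have := uvec_abs K k
      gcongr
    have h2 := abs_sub lam (lam * eta * (1 - 2 * pi) * uvec K k)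
    rw [abs_of_nonneg hl0] at h2
    linarith

lemma mem_mk {K : ℕ} (hK : 2 ≤ K) {L δ ε ζ lam pi eta : ℝ} (hL : L ≤ 1 / 3)
    (hδ0 : 0 < δ) (hδ : δ ≤ 1 / 6) (hε0 : 0 < ε) (hεl : ε ≤ lam) (hl : lam ≤ 1 / 6)
    (hp0 : 2 * δ ≤ pi) (hp : pi ≤ 2 / 3) (he0 : 0 ≤ eta) (he : eta ≤ 1 / 2)
    (hz : ζ ≤ eta * Real.sqrt (2 * ((K / 2 : ℕ) : ℝ)) / K) :
    mkP K (uvec K) lam pi eta ∈ ThetaL K L δ ε ζ := by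
  have hK' : (0 : ℝ) < K := by exact_mod_cast (by omega : 0 < K)
  have hlabs : |1 - (1 - lam) * pi - (1 - lam) * (1 - pi)| = lam := by
    rw [show 1 - (1 - lam) * pi - (1 - lam) * (1 - pi) = lam by ring]
    exact abs_of_pos (by linarith)
  have dens : ∀ t : ℝ, |t| ≤ 1 → IsDensity (fun k => (1 + t * uvec K k) / (K : ℝ)) := by
    intro t ht
    refine ⟨fun k => ?_, ?_⟩
    · have h1 : |t * uvec K k| ≤ 1 := by
        rw [abs_mul]; exact mul_le_one₀ ht (abs_nonneg _) (uvec_abs K k)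
      have := (abs_le.1 h1).1
      exact div_nonneg (by linarith) hK'.le
    · rw [← Finset.sum_div, Finset.sum_add_distrib, ← Finset.mul_sum, uvec_sum]
      simp [hK'.ne']
  refine ⟨⟨⟨⟨?_, ?_⟩, ⟨?_, ?_⟩, ?_, ?_⟩, ?_, ?_, ?_, ?_⟩, ?_⟩
  · change 0 < (1 - lam) * pi
    exact mul_pos (by linarith) (by linarith)
  · change (1 - lam) * pi < 1
    nlinarith
  · change 0 < (1 - lam) * (1 - pi)
    exact mul_pos (by linarith) (by linarith)
  · change (1 - lam) * (1 - pi) < 1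
    nlinarith
  · refine dens (eta * pi) (abs_le.2 ⟨by nlinarith, by nlinarith⟩)
  · have := dens (-(eta * (1 - pi))) (abs_le.2 ⟨by nlinarith, by nlinarith⟩)
    convert this using 2
    simp only [mkP]
    ring
  · change δ ≤ (1 - lam) * pi
    nlinarith
  · change δ ≤ (1 - lam) * (1 - pi)
    nlinarith
  · change ε ≤ |1 - (1 - lam) * pi - (1 - lam) * (1 - pi)|
    rw [hlabs]; exact hεl
  · refine hz.trans (le_of_eq ?_)
    unfold enormF
    have : ∀ k, ((mkP K (uvec K) lam pi eta).f0 k - (mkP K (uvec K) lam pi eta).f1 k) ^ 2 =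
        (eta / K) ^ 2 * uvec K k ^ 2 := by
      intro k
      simp only [mkP]
      field_simp
      ring
    simp only [this]
    rw [← Finset.mul_sum, uvec_sq, Real.sqrt_mul (sq_nonneg (eta / (K : ℝ))),
      Real.sqrt_sq (by positivity)]
    ring
  · change L ≤ 1 - |1 - (1 - lam) * pi - (1 - lam) * (1 - pi)|
    rw [hlabs]; linarith

open Classical in
lemma lecam {Ω : Type*} [Fintype Ω] (P Q : Ω → ℝ) (hP : ∀ y, 0 < P y) (hQ : ∀ y, 0 < Q y)
    (hP1 : ∑ y, P y = 1) (hchi : ∑ y, P y ^ 2 / Q y ≤ 2) (E F : Ω → Prop)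
    (hEF : ∀ y, E y ∨ F y) :
    1 / 2 ≤ (∑ y, if E y then P y else 0) + ∑ y, if F y then Q y else 0 := by
  have h : ∑ y, (P y - P y ^ 2 / Q y / 4) ≤
      (∑ y, if E y then P y else 0) + ∑ y, if F y then Q y else 0 := by
    rw [← Finset.sum_add_distrib]
    refine Finset.sum_le_sum fun y _ => ?_
    have hp := hP y
    have hq := hQ y
    have h1 : 0 ≤ P y ^ 2 / Q y := by positivity
    have h2 : P y - P y ^ 2 / Q y / 4 ≤ Q y := by
      have : P y ^ 2 / Q y / 4 = (Q y - P y / 2) ^ 2 / Q y - Q y + P y := by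
        field_simp
        ring
      have h3 : 0 ≤ (Q y - P y / 2) ^ 2 / Q y := by positivity
      linarith
    by_cases hE : E y
    · rw [if_pos hE]
      split_ifs <;> linarith
    · rw [if_neg hE, if_pos ((hEF y).resolve_left hE)]
      linarith
  rw [Finset.sum_sub_distrib, ← Finset.sum_div, hP1] at h
  linarith

lemma probOf_bdd {K : ℕ} (θ : Param K) (hθ : Valid θ) (n : ℕ) (E : (Fin n → Fin K) → Prop) :
    probOf θ n E ≤ ∑ _y : Fin n → Fin K, ∑ _x : Fin n → Fin 2, (1 : ℝ) := by
  obtain ⟨⟨hp0, hp1⟩, ⟨hq0, hq1⟩, hf0, hf1⟩ := hθ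
  have dle : ∀ f : Fin K → ℝ, IsDensity f → ∀ k, f k ≤ 1 := fun f hf k => by
    rw [← hf.2]
    exact Finset.single_le_sum (fun i _ => hf.1 i) (Finset.mem_univ k)
  have hi : ∀ a, 0 ≤ initD θ a ∧ initD θ a ≤ 1 := by
    intro a
    have : 0 < θ.p + θ.q := by linarith
    unfold initD
    split_ifs
    · exact ⟨by positivity, by rw [div_le_one this]; linarith⟩
    · exact ⟨by positivity, by rw [div_le_one this]; linarith⟩
  have ht : ∀ a b, 0 ≤ transP θ a b ∧ transP θ a b ≤ 1 := by
    intro a b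
    unfold transP
    split_ifs <;> constructor <;> linarith
  have he : ∀ a k, 0 ≤ emit θ a k ∧ emit θ a k ≤ 1 := by
    intro a k
    unfold emit
    split_ifs
    · exact ⟨hf0.1 k, dle _ hf0 k⟩
    · exact ⟨hf1.1 k, dle _ hf1 k⟩
  unfold probOf
  refine Finset.sum_le_sum fun y _ => ?_
  have hpl : pLaw θ n y ≤ ∑ _x : Fin n → Fin 2, (1 : ℝ) := by
    unfold pLaw
    refine Finset.sum_le_sum fun x _ => ?_
    refine mul_le_one₀ ?_ ?_ ?_
    · refine Finset.prod_le_one (fun i _ => ?_) (fun i _ => ?_)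
      · split_ifs
        · exact (hi _).1
        · exact (ht _ _).1
      · split_ifs
        · exact (hi _).2
        · exact (ht _ _).2
    · exact Finset.prod_nonneg fun i _ => (he _ _).1
    · exact Finset.prod_le_one (fun i _ => (he _ _).1) (fun i _ => (he _ _).2)
  split_ifs
  · exact hpl
  · positivity

lemma le_sup_prob {K : ℕ} {L δ ε ζ : ℝ} (n : ℕ) (E : Param K → (Fin n → Fin K) → Prop)
    (θ : Param K) (hθ : θ ∈ ThetaL K L δ ε ζ) :
    probOf θ n (E θ) ≤ ⨆ θ ∈ ThetaL K L δ ε ζ, probOf θ n (E θ) := by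
  have hB : BddAbove (Set.range fun θ => ⨆ _ : θ ∈ ThetaL K L δ ε ζ, probOf θ n (E θ)) := by
    refine ⟨∑ _y : Fin n → Fin K, ∑ _x : Fin n → Fin 2, (1 : ℝ), ?_⟩
    rintro _ ⟨θ, rfl⟩
    refine Real.iSup_le (fun h => probOf_bdd θ h.1.1 n _) (by positivity)
  refine le_trans ?_ (le_ciSup hB θ)
  simp [hθ]

lemma two_point {K : ℕ} (hK : 2 ≤ K) {L δ ε ζ lam pi eta lam' pi' eta' E thr : ℝ} (n : ℕ)
    (phat qhat : (Fin n → Fin K) → ℝ)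
    (hl1 : lam < 1) (hl1' : lam' < 1)
    (hm : mkP K (uvec K) lam pi eta ∈ ThetaL K L δ ε ζ)
    (hm' : mkP K (uvec K) lam' pi' eta' ∈ ThetaL K L δ ε ζ)
    (hg : Good (uvec K) (lam * eta ^ 2 * (pi * (1 - pi))) lam (lam * eta * (1 - 2 * pi)))
    (hg' : Good (uvec K) (lam' * eta' ^ 2 * (pi' * (1 - pi'))) lam' (lam' * eta' * (1 - 2 * pi')))
    (hrho : lam * eta ^ 2 * (pi * (1 - pi)) = lam' * eta' ^ 2 * (pi' * (1 - pi')))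
    (hE : |lam - lam'| + |lam * eta * (1 - 2 * pi) - lam' * eta' * (1 - 2 * pi')| ≤ E)
    (hn : n * (|lam * eta ^ 2 * (pi * (1 - pi))| * E) ^ 2 ≤ 1 / 256)
    (hsep : 2 * thr < |(1 - lam) * pi - (1 - lam') * pi'| ∨
      2 * thr < |(1 - lam) * (1 - pi) - (1 - lam') * (1 - pi')|) :
    1 / 4 ≤ ⨆ θ ∈ ThetaL K L δ ε ζ,
      probOf θ n (fun y => thr < max |phat y - θ.p| |qhat y - θ.q|) := by
  have hK0 : 0 < K := by omega
  have s1 := le_sup_prob n (fun θ y => thr < max |phat y - θ.p| |qhat y - θ.q|) _ hm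
  have s2 := le_sup_prob n (fun θ y => thr < max |phat y - θ.p| |qhat y - θ.q|) _ hm'
  have hl := fun y => pLaw_law hK0 hl1 hg n y
  have hl' := fun y => pLaw_law hK0 hl1' hg' n y
  rw [← hrho] at hg' hl'
  have hE0 : 0 ≤ E := le_trans (by positivity) hE
  have hchi := law_chi hK0 (uvec_sum K) hg hg' (E := E) hE0 (by
    intro k
    refine le_trans ?_ hE
    have e : lam - lam * eta * (1 - 2 * pi) * uvec K k -
        (lam' - lam' * eta' * (1 - 2 * pi') * uvec K k) =
        (lam - lam') - (lam * eta * (1 - 2 * pi) - lam' * eta' * (1 - 2 * pi')) * uvec K k := by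
      ring
    rw [e]
    refine (abs_sub _ _).trans ?_
    rw [abs_mul]
    gcongr
    exact mul_le_of_le_one_right (abs_nonneg _) (uvec_abs K k)) n
  have hexp : (1 + 2 * (8 * |lam * eta ^ 2 * (pi * (1 - pi))| * E) ^ 2) ^ n ≤ 2 := by
    set R := |lam * eta ^ 2 * (pi * (1 - pi))| with hR
    have h1 : 1 + 2 * (8 * R * E) ^ 2 ≤ Real.exp (2 * (8 * R * E) ^ 2) := by
      have := Real.add_one_le_exp (2 * (8 * R * E) ^ 2); linarith
    calc (1 + 2 * (8 * R * E) ^ 2) ^ n ≤ (Real.exp (2 * (8 * R * E) ^ 2)) ^ n := by gcongr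
      _ = Real.exp (n * (2 * (8 * R * E) ^ 2)) := by rw [← Real.exp_nat_mul]
      _ ≤ Real.exp (1 / 2) := by
          apply Real.exp_le_exp.2
          nlinarith
      _ ≤ 2 := by
          have h3 : Real.exp (1 / 2) * Real.exp (1 / 2) = Real.exp 1 := by
            rw [← Real.exp_add]; norm_num
          have h4 := Real.exp_one_lt_d9
          nlinarith [Real.exp_pos (1 / 2)]
  have key := lecam _ _ (law_pos hK0 hg n) (law_pos hK0 hg' n) (law_sum hK0 (uvec_sum K) _ _ _ n)
    (hchi.trans hexp)
    (fun y => thr < max |phat y - (mkP K (uvec K) lam pi eta).p|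
      |qhat y - (mkP K (uvec K) lam pi eta).q|)
    (fun y => thr < max |phat y - (mkP K (uvec K) lam' pi' eta').p|
      |qhat y - (mkP K (uvec K) lam' pi' eta').q|) (by
    intro y
    by_contra hcon
    rw [not_or, not_lt, not_lt, max_le_iff, max_le_iff] at hcon
    simp only [mkP] at hcon
    obtain ⟨⟨c1, c2⟩, c3, c4⟩ := hcon
    rw [abs_le] at c1 c2 c3 c4
    rcases hsep with hs | hs
    · refine absurd hs (not_lt.2 (abs_le.2 ⟨?_, ?_⟩)) <;> linarith [c1.1, c1.2, c3.1, c3.2]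
    · refine absurd hs (not_lt.2 (abs_le.2 ⟨?_, ?_⟩)) <;> linarith [c2.1, c2.2, c4.1, c4.2])
  simp only [← hl, ← hl'] at key
  have key2 : 1 / 2 ≤ probOf (mkP K (uvec K) lam pi eta) n
      (fun y => thr < max |phat y - (mkP K (uvec K) lam pi eta).p|
      |qhat y - (mkP K (uvec K) lam pi eta).q|) +
      probOf (mkP K (uvec K) lam' pi' eta') n
      (fun y => thr < max |phat y - (mkP K (uvec K) lam' pi' eta').p|
      |qhat y - (mkP K (uvec K) lam' pi' eta').q|) := by
    unfold probOf
    exact key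
  linarith

lemma num_bound {n : ℕ} {δ ε ζ z a R E k : ℝ} (hR0 : 0 ≤ R) (hE0 : 0 ≤ E) (hδ : 0 < δ)
    (hε : 0 < ε) (hz : 0 ≤ z) (ha : 0 ≤ a)
    (hR : R ≤ 4 * δ * ε * z ^ 2) (hE : E ≤ 8 * a * ε * z) (hzk : z ≤ k * ζ)
    (hc : a ^ 2 * (n * δ ^ 2 * ε ^ 4 * ζ ^ 6) * k ^ 6 ≤ 1 / 262144) :
    n * (R * E) ^ 2 ≤ 1 / 256 := by
  have h1 : n * (R * E) ^ 2 ≤ n * ((4 * δ * ε * z ^ 2) * (8 * a * ε * z)) ^ 2 := by gcongr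
  have h2 : z ^ 6 ≤ (k * ζ) ^ 6 := by gcongr
  have h3 : n * ((4 * δ * ε * z ^ 2) * (8 * a * ε * z)) ^ 2 =
      1024 * (n * a ^ 2 * δ ^ 2 * ε ^ 4) * z ^ 6 := by ring
  have h4 : 1024 * (n * a ^ 2 * δ ^ 2 * ε ^ 4) * z ^ 6 ≤
      1024 * (n * a ^ 2 * δ ^ 2 * ε ^ 4) * (k * ζ) ^ 6 := by gcongr
  nlinarith

set_option maxHeartbeats 2000000 in
theorem statement2 (K : ℕ) (hK : 2 ≤ K) :
    ∃ c ε₁ : ℝ, 0 < c ∧ 0 < ε₁ ∧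
      ∀ (L δ ε ζ : ℝ) (n : ℕ),
        0 < L → L ≤ 1 / 3 →
        δ ∈ Set.Ioo (0 : ℝ) 1 → δ ≤ 1 / 6 →
        ε ∈ Set.Ioo (0 : ℝ) 1 → ε ≤ ε₁ →
        0 < ζ → ζ ≤ Real.sqrt (2 * ((K / 2 : ℕ) : ℝ)) / (4 * K) →
        1 ≤ n * δ ^ 2 * ε ^ 4 * ζ ^ 6 →
        ∀ (phat qhat : (Fin n → Fin K) → ℝ)
          (f0hat f1hat : (Fin n → Fin K) → Fin K → ℝ),
          1 / 4 ≤ ⨆ θ ∈ ThetaL K L δ ε ζ,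
            probOf θ n (fun y =>
              c / Real.sqrt (n * δ ^ 2 * ε ^ 4 * ζ ^ 6) * max δ (ε * ζ)
                < max |phat y - θ.p| |qhat y - θ.q|) := by

  have hK' : (2 : ℝ) ≤ K := by exact_mod_cast hK
  have hKpos : (0 : ℝ) < K := by linarith
  refine ⟨1 / (512 * K ^ 3), 1 / 12, by positivity, by norm_num, ?_⟩
  intro L δ ε ζ n hL0 hL ⟨hδ0, _⟩ hδ ⟨hε0, _⟩ hε hζ0 hζ hN phat qhat _ _
  set w := Real.sqrt (2 * ((K / 2 : ℕ) : ℝ)) with hw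
  have hm1 : (1 : ℝ) ≤ ((K / 2 : ℕ) : ℝ) := by exact_mod_cast (by omega : 1 ≤ K / 2)
  have hm2 : 2 * ((K / 2 : ℕ) : ℝ) ≤ K := by exact_mod_cast (by omega : 2 * (K / 2) ≤ K)
  have hw1 : 1 ≤ w := by
    rw [hw]; exact Real.one_le_sqrt.2 (by linarith)
  have hwK : w ≤ K := by
    rw [hw]; exact Real.sqrt_le_iff.2 ⟨hKpos.le, by nlinarith⟩
  have hw0 : 0 < w := by linarith
  obtain ⟨z, hz⟩ : ∃ z, z = K * ζ / w := ⟨_, rfl⟩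
  have hz0 : 0 < z := by rw [hz]; positivity
  have hz4 : z ≤ 1 / 4 := by
    rw [hz, div_le_iff₀ hw0]
    rw [le_div_iff₀ (by positivity)] at hζ
    linarith
  have hζw : ζ = z * w / K := by rw [hz]; field_simp
  have hζz : ζ ≤ z := by
    rw [hζw, div_le_iff₀ hKpos]; gcongr
  have hzK : z ≤ K * ζ := by
    rw [hz]; exact div_le_self (by positivity) hw1
  have hζeta : ∀ eta, z ≤ eta → ζ ≤ eta * w / K := by
    intro eta h; rw [hζw]; gcongr
  set N := (n : ℝ) * δ ^ 2 * ε ^ 4 * ζ ^ 6 with hNdef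
  obtain ⟨a, ha⟩ : ∃ a, a = 1 / (512 * (K : ℝ) ^ 3) / Real.sqrt N := ⟨_, rfl⟩
  rw [← ha]
  have hsN : 1 ≤ Real.sqrt N := Real.one_le_sqrt.2 hN
  have hK3 : (1 : ℝ) ≤ K ^ 3 := one_le_pow₀ (by linarith)
  have ha0 : 0 < a := by rw [ha]; positivity
  have ha1 : a ≤ 1 / 512 := by
    rw [ha]
    refine (div_le_self (by positivity) hsN).trans ?_
    exact one_div_le_one_div_of_le (by norm_num) (by linarith)
  have hc : a ^ 2 * N * K ^ 6 ≤ 1 / 262144 := by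
    rw [ha, div_pow, Real.sq_sqrt (by linarith)]
    have : N ≠ 0 := by linarith
    apply le_of_eq
    field_simp
    norm_num
  rcases le_or_gt (ε * ζ) δ with hcase | hcase
  · -- change of the stationary law
    rw [max_eq_left hcase]
    obtain ⟨x, hx⟩ : ∃ x, x = 4 * a := ⟨_, rfl⟩
    have hx0 : 0 < x := by linarith
    have hx1 : x ≤ 1 := by linarith
    obtain ⟨π, hπ⟩ : ∃ π, π = 2 * δ := ⟨_, rfl⟩
    obtain ⟨π', hπ'⟩ : ∃ π', π' = 2 * δ * (1 + x) := ⟨_, rfl⟩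
    have hπ0 : 0 < π := by linarith
    have hππ : π' = π * (1 + x) := by rw [hπ', hπ]
    have hπ3 : π ≤ 1 / 3 := by linarith
    have hπ'1 : π ≤ π' := by rw [hππ]; exact le_mul_of_one_le_right hπ0.le (by linarith)
    have hπ'2 : π' ≤ 2 * π := by
      rw [hππ, mul_comm 2]; exact mul_le_mul_of_nonneg_left (by linarith) hπ0.le
    obtain ⟨ra, hra⟩ : ∃ ra, ra = (1 + x) * (1 - π') / (1 - π) := ⟨_, rfl⟩
    have h1π : 0 < 1 - π := by linarith
    have hra1 : 1 ≤ ra := by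
      rw [hra, le_div_iff₀ h1π, hππ]
      have h6 : π * (2 + x) ≤ (1 / 3) * 3 :=
        mul_le_mul hπ3 (by linarith) (by linarith) (by norm_num)
      have h7 : 0 ≤ x * (1 - π * (2 + x)) := mul_nonneg hx0.le (by linarith)
      have h8 : (1 + x) * (1 - π * (1 + x)) - 1 * (1 - π) = x * (1 - π * (2 + x)) := by ring
      linarith
    have hra2 : ra ≤ 1 + x := by
      rw [hra, div_le_iff₀ h1π]
      exact mul_le_mul_of_nonneg_left (by linarith) (by linarith)
    obtain ⟨s, hs⟩ : ∃ s, s = Real.sqrt ra := ⟨_, rfl⟩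
    have hs1 : 1 ≤ s := by rw [hs]; exact Real.one_le_sqrt.2 hra1
    have hss : s ^ 2 = ra := by rw [hs]; exact Real.sq_sqrt (by linarith)
    have hsx : s ≤ 1 + x := by
      have : s ≤ s ^ 2 := le_self_pow₀ hs1 (by norm_num)
      linarith
    have hrho : ε * (z * s) ^ 2 * (π * (1 - π)) = ε * z ^ 2 * (π' * (1 - π')) := by
      rw [mul_pow, hss, hra, hππ]
      field_simp
    have hzs : z * s ≤ 1 / 2 := by
      have : z * s ≤ (1 / 4) * 2 := mul_le_mul hz4 (by linarith) (by linarith) (by norm_num)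
      linarith
    have hzs' : z ≤ z * s := le_mul_of_one_le_right hz0.le hs1
    refine two_point hK (lam := ε) (lam' := ε) (pi := π) (pi' := π') (eta := z * s) (eta' := z)
      (E := 8 * a * ε * z) n phat qhat (by linarith) (by linarith)
      (mem_mk hK hL hδ0 hδ hε0 le_rfl (by linarith) hπ.ge (by linarith) (by linarith) hzs
        (hζeta _ hzs'))
      (mem_mk hK hL hδ0 hδ hε0 le_rfl (by linarith) (by linarith) (by linarith) (by linarith)
        (by linarith) (hζeta _ le_rfl))
      (good_mk (by linarith) (by linarith) (by linarith) (by linarith) (by linarith) hzs)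
      (good_mk (by linarith) (by linarith) (by linarith) (by linarith) (by linarith)
        (by linarith))
      hrho ?_ ?_ ?_
    · rw [sub_self, abs_zero, zero_add]
      have e : ε * (z * s) * (1 - 2 * π) - ε * z * (1 - 2 * π') =
          ε * z * ((s - 1) * (1 - 2 * π) + 2 * (π' - π)) := by ring
      have h1 : 0 ≤ (s - 1) * (1 - 2 * π) := mul_nonneg (by linarith) (by linarith)
      have h2 : (s - 1) * (1 - 2 * π) ≤ x :=
        (mul_le_of_le_one_right (by linarith) (by linarith)).trans (by linarith)
      have h3 : 2 * (π' - π) ≤ x := by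
        have : π * x ≤ (1 / 3) * x := mul_le_mul_of_nonneg_right hπ3 hx0.le
        have e3 : 2 * (π' - π) = 2 * (π * x) := by rw [hππ]; ring
        linarith
      rw [e, abs_of_nonneg (by
        refine mul_nonneg (by positivity) ?_
        linarith)]
      calc ε * z * ((s - 1) * (1 - 2 * π) + 2 * (π' - π)) ≤ ε * z * (2 * x) := by
            gcongr; linarith
        _ = 8 * a * ε * z := by rw [hx]; ring
    · refine num_bound (δ := δ) (ε := ε) (ζ := ζ) (z := z) (a := a) (k := K)
        (abs_nonneg _) (by positivity) hδ0 hε0 hz0.le ha0.le ?_ le_rfl hzK hc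
      rw [hrho, abs_of_nonneg (mul_nonneg (by positivity) (mul_nonneg (by linarith) (by linarith)))]
      have : π' * (1 - π') ≤ 4 * δ :=
        (mul_le_of_le_one_right (by linarith) (by linarith)).trans (by linarith)
      calc ε * z ^ 2 * (π' * (1 - π')) ≤ ε * z ^ 2 * (4 * δ) := by gcongr
        _ = _ := by ring
    · left
      have e : (1 - ε) * π - (1 - ε) * π' = -((1 - ε) * (8 * (a * δ))) := by
        rw [hππ, hπ, hx]; ring
      have hp : 0 < a * δ := by positivity
      rw [e, abs_neg, abs_of_pos (mul_pos (by linarith) (by linarith))]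
      have h9 := mul_le_mul_of_nonneg_right (show 1 / 2 ≤ 1 - ε by linarith) hp.le
      linarith
  · -- change of the second eigenvalue
    rw [max_eq_right hcase.le]
    obtain ⟨x, hx⟩ : ∃ x, x = 4 * a * ζ := ⟨_, rfl⟩
    have hx0 : 0 < x := by rw [hx]; positivity
    have hx1 : x ≤ 1 := by
      rw [hx]; exact mul_le_one₀ (by linarith) hζ0.le (by linarith)
    obtain ⟨π, hπ⟩ : ∃ π, π = 2 * δ := ⟨_, rfl⟩
    have hπ0 : 0 < π := by linarith
    have hπ3 : π ≤ 1 / 3 := by linarith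
    obtain ⟨s, hs⟩ : ∃ s, s = Real.sqrt (1 + x) := ⟨_, rfl⟩
    have hs1 : 1 ≤ s := by rw [hs]; exact Real.one_le_sqrt.2 (by linarith)
    have hss : s ^ 2 = 1 + x := by rw [hs]; exact Real.sq_sqrt (by linarith)
    have hsx : s ≤ 1 + x := by
      have : s ≤ s ^ 2 := le_self_pow₀ hs1 (by norm_num)
      linarith
    have hrho : ε * (1 + x) * z ^ 2 * (π * (1 - π)) = ε * (z * s) ^ 2 * (π * (1 - π)) := by
      rw [mul_pow, hss]; ring
    have hzs : z * s ≤ 1 / 2 := by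
      have : z * s ≤ (1 / 4) * 2 := mul_le_mul hz4 (by linarith) (by linarith) (by norm_num)
      linarith
    have hzs' : z ≤ z * s := le_mul_of_one_le_right hz0.le hs1
    have hεx : ε ≤ ε * (1 + x) := le_mul_of_one_le_right hε0.le (by linarith)
    have hεx' : ε * (1 + x) ≤ 2 * ε := by
      rw [mul_comm 2]; exact mul_le_mul_of_nonneg_left (by linarith) hε0.le
    refine two_point hK (lam := ε * (1 + x)) (lam' := ε) (pi := π) (pi' := π) (eta := z)
      (eta' := z * s)
      (E := 2 * ε * x) n phat qhat (by linarith) (by linarith)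
      (mem_mk hK hL hδ0 hδ hε0 hεx (by linarith) hπ.ge (by linarith) (by linarith) (by linarith)
        (hζeta _ le_rfl))
      (mem_mk hK hL hδ0 hδ hε0 le_rfl (by linarith) hπ.ge (by linarith) (by linarith)
        hzs (hζeta _ hzs'))
      (good_mk (by linarith) (by linarith) (by linarith) (by linarith) (by linarith) (by linarith))
      (good_mk (by linarith) (by linarith) (by linarith) (by linarith) (by linarith) hzs)
      hrho ?_ ?_ ?_
    · have e0 : ε * (1 + x) - ε = ε * x := by ring
      have e : ε * (1 + x) * z * (1 - 2 * π) - ε * (z * s) * (1 - 2 * π) =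
          ε * (z * ((1 + x - s) * (1 - 2 * π))) := by ring
      have h1 : 0 ≤ (1 + x - s) * (1 - 2 * π) := mul_nonneg (by linarith) (by linarith)
      have h2 : (1 + x - s) * (1 - 2 * π) ≤ x :=
        (mul_le_of_le_one_right (by linarith) (by linarith)).trans (by linarith)
      have h3 : z * ((1 + x - s) * (1 - 2 * π)) ≤ x :=
        (mul_le_of_le_one_left h1 (by linarith)).trans h2
      rw [e0, e, abs_of_nonneg (by positivity), abs_of_nonneg (by positivity)]
      have h4 := mul_le_mul_of_nonneg_left h3 hε0.le
      linarith
    · refine num_bound (δ := δ) (ε := ε) (ζ := ζ) (z := z) (a := a) (k := K)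
        (abs_nonneg _) (by positivity) hδ0 hε0 hz0.le ha0.le ?_ ?_ hzK hc
      · rw [abs_of_nonneg (mul_nonneg (by positivity) (mul_nonneg (by linarith) (by linarith)))]
        have h1 : π * (1 - π) ≤ 2 * δ :=
          (mul_le_of_le_one_right (by linarith) (by linarith)).trans (by linarith)
        calc ε * (1 + x) * z ^ 2 * (π * (1 - π)) ≤ 2 * ε * z ^ 2 * (2 * δ) := by
              gcongr
              exact mul_nonneg hπ0.le (by linarith)
          _ = _ := by ring
      · rw [hx]
        calc 2 * ε * (4 * a * ζ) = 8 * a * ε * ζ := by ring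
          _ ≤ 8 * a * ε * z := by gcongr
    · right
      have e : (1 - ε * (1 + x)) * (1 - π) - (1 - ε) * (1 - π) =
          -((1 - π) * (4 * (a * (ε * ζ)))) := by
        rw [hx]; ring
      have hp : 0 < a * (ε * ζ) := by positivity
      rw [e, abs_neg, abs_of_pos (mul_pos (by linarith) (by linarith))]
      have h9 := mul_le_mul_of_nonneg_right (show 2 / 3 ≤ 1 - π by linarith) hp.le
      linarith

end PaperHMM
end

section
/- For any θ=(p,q,f₀,f₁) with p,q∈(0,1) and f₀≠f₁, writing (φ,ψ)=(φ(θ),ψ(θ)), the law of three consecutive observations satisfies the identity p_θ^{(3)} = ψ₁⊗ψ₁⊗ψ₁ + r(φ)·(ψ₂⊗ψ₂⊗ψ₁ + ψ₁⊗ψ₂⊗ψ₂) + φ₂·r(φ)·ψ₂⊗ψ₁⊗ψ₂ − φ₁·φ₂·φ₃·r(φ)·ψ₂⊗ψ₂⊗ψ₂, where r(φ)=¼(1−φ₁²)φ₂φ₃². Equivalently, p_θ^{(3)} = (q/(p+q))·g⊗f₀⊗g + (p/(p+q))·h⊗f₁⊗h with g=(1−p)f₀+pf₁ and h=qf₀+(1−q)f₁.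 -/
open scoped BigOperators

namespace PaperHMM

/-- Enumeration of the hidden paths of length three. -/
theorem univ_paths : (Finset.univ : Finset (Fin 3 → Fin 2)) =
    {![0,0,0], ![0,0,1], ![0,1,0], ![0,1,1], ![1,0,0], ![1,0,1], ![1,1,0], ![1,1,1]} := by
  decide

theorem pLaw_three {K : ℕ} (θ : Param K) (y : Fin 3 → Fin K) (h : θ.p + θ.q ≠ 0) :
    pLaw θ 3 y =
        (θ.q / (θ.p + θ.q)) *
            (((1 - θ.p) * θ.f0 (y 0) + θ.p * θ.f1 (y 0)) * θ.f0 (y 1) *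
              ((1 - θ.p) * θ.f0 (y 2) + θ.p * θ.f1 (y 2)))
          + (θ.p / (θ.p + θ.q)) *
            ((θ.q * θ.f0 (y 0) + (1 - θ.q) * θ.f1 (y 0)) * θ.f1 (y 1) *
              (θ.q * θ.f0 (y 2) + (1 - θ.q) * θ.f1 (y 2))) := by
  unfold pLaw
  rw [univ_paths]
  repeat rw [Finset.sum_insert (by decide)]
  rw [Finset.sum_singleton]
  simp [Fin.prod_univ_three, initD, transP, emit]
  field_simp
  ring

theorem enormF_ne_zero {K : ℕ} (f g : Fin K → ℝ) (h : f ≠ g) :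
    enormF (fun k => f k - g k) ≠ 0 := by
  intro h0
  apply h
  unfold enormF at h0
  rw [Real.sqrt_eq_zero (Finset.sum_nonneg fun i _ => sq_nonneg _),
    Finset.sum_eq_zero_iff_of_nonneg (fun i _ => sq_nonneg _)] at h0
  funext k
  have := h0 k (Finset.mem_univ k)
  exact sub_eq_zero.mp (pow_eq_zero_iff (two_ne_zero) |>.mp this)

theorem statement4 (K : ℕ) (hK : 2 ≤ K) (θ : Param K)
    (hp : θ.p ∈ Set.Ioo (0 : ℝ) 1) (hq : θ.q ∈ Set.Ioo (0 : ℝ) 1)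
    (hd0 : IsDensity θ.f0) (hd1 : IsDensity θ.f1) (hne : θ.f0 ≠ θ.f1) :
    (∀ y : Fin 3 → Fin K,
      pLaw θ 3 y =
        (psiOf θ).1 (y 0) * (psiOf θ).1 (y 1) * (psiOf θ).1 (y 2)
          + rfun (phiOf θ) *
              ((psiOf θ).2 (y 0) * (psiOf θ).2 (y 1) * (psiOf θ).1 (y 2)
                + (psiOf θ).1 (y 0) * (psiOf θ).2 (y 1) * (psiOf θ).2 (y 2))
          + (phiOf θ).2.1 * rfun (phiOf θ) *
              ((psiOf θ).2 (y 0) * (psiOf θ).1 (y 1) * (psiOf θ).2 (y 2))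
          - (phiOf θ).1 * (phiOf θ).2.1 * (phiOf θ).2.2 * rfun (phiOf θ) *
              ((psiOf θ).2 (y 0) * (psiOf θ).2 (y 1) * (psiOf θ).2 (y 2)))
    ∧ (∀ y : Fin 3 → Fin K,
      pLaw θ 3 y =
        (θ.q / (θ.p + θ.q)) *
            (((1 - θ.p) * θ.f0 (y 0) + θ.p * θ.f1 (y 0)) * θ.f0 (y 1) *
              ((1 - θ.p) * θ.f0 (y 2) + θ.p * θ.f1 (y 2)))
          + (θ.p / (θ.p + θ.q)) *
            ((θ.q * θ.f0 (y 0) + (1 - θ.q) * θ.f1 (y 0)) * θ.f1 (y 1) *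
              (θ.q * θ.f0 (y 2) + (1 - θ.q) * θ.f1 (y 2)))) := by
  have h : θ.p + θ.q ≠ 0 := (add_pos hp.1 hq.1).ne'
  refine ⟨fun y => ?_, fun y => pLaw_three θ y h⟩
  have hn := enormF_ne_zero θ.f0 θ.f1 hne
  rw [pLaw_three θ y h]
  simp only [psiOf, phiOf, rfun]
  generalize enormF (fun k => θ.f0 k - θ.f1 k) = n at hn ⊢
  field_simp
  ring

end PaperHMM
end

section
/- There exists a constant c₁=c₁(K)>0 such that for all parameter pairs (φ,ψ) and (φ̃,ψ̃) in ∪_{δ,ε,ζ} Φ(δ,ε,ζ), one has c₁·ρ((φ,ψ);(φ̃,ψ̃)) ≤ ‖p^{(3)}_{φ,ψ} − p^{(3)}_{φ̃,ψ̃}‖, where ‖·‖ is the Euclidean norm on ℝ^{K×K×K} and p^{(3)}_{φ,ψ} denotes p^{(3)}_{θ(φ,ψ)}. -/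
open scoped BigOperators

namespace PaperHMM

/-- Triples as functions on `Fin 3`. -/
def tripleEquiv (α : Type*) : α × α × α ≃ (Fin 3 → α) where
  toFun t := ![t.1, t.2.1, t.2.2]
  invFun x := (x 0, x 1, x 2)
  left_inv t := by simp
  right_inv x := by
    ext i
    fin_cases i <;> rfl

lemma sum_triple {α : Type*} [Fintype α] (F : (Fin 3 → α) → ℝ) :
    ∑ x, F x = ∑ a, ∑ b, ∑ c, F ![a, b, c] := by
  rw [← (tripleEquiv α).sum_comp, Fintype.sum_prod_type]
  refine Finset.sum_congr rfl fun a _ => ?_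
  rw [Fintype.sum_prod_type]
  rfl

/-- Expansion of the law of three observations. -/
lemma p3_expand {K : ℕ} (π : PP K) (h : 1 - π.1.2.1 ≠ 0) (a b c : Fin K) :
    p3 π ![a, b, c] = π.2.1 a * π.2.1 b * π.2.1 c
      + (mvec π.1).1 * (π.2.2 a * π.2.2 b * π.2.1 c + π.2.1 a * π.2.2 b * π.2.2 c)
      + (mvec π.1).2.1 * (π.2.2 a * π.2.1 b * π.2.2 c)
      - (mvec π.1).2.2 * (π.2.2 a * π.2.2 b * π.2.2 c) := by
  have h0 : (unpack π).q / ((unpack π).p + (unpack π).q) = (1 + π.1.1) / 2 := by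
    simp only [unpack]
    rw [div_eq_div_iff]
    · ring
    · intro h'; apply h; linarith
    · norm_num
  have h1 : (unpack π).p / ((unpack π).p + (unpack π).q) = (1 - π.1.1) / 2 := by
    simp only [unpack]
    rw [div_eq_div_iff]
    · ring
    · intro h'; apply h; linarith
    · norm_num
  unfold p3 pLaw
  rw [sum_triple]
  simp only [Fin.sum_univ_two, Fin.prod_univ_three, initD, transP, emit, h0, h1]
  simp [unpack, mvec, rfun]
  ring

/-- The constraints on the reparametrised parameters used in the proof. -/
lemma facts {K : ℕ} (π : PP K) (hπ : π ∈ PhiAll K) :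
    1 - π.1.2.1 ≠ 0 ∧ (∀ a, |π.2.1 a| ≤ 1) ∧ ∑ a, π.2.1 a = 1 ∧ ∑ a, π.2.2 a = 0 ∧
      ∑ a, π.2.2 a ^ 2 = 1 ∧ |(mvec π.1).1| ≤ 1 ∧ |(mvec π.1).2.1| ≤ 1 := by
  simp only [PhiAll, Set.mem_iUnion, PhiSet] at hπ
  obtain ⟨δ, hδ, ε, hε, ζ, hζ, θ, hθ, rfl⟩ := hπ
  obtain ⟨⟨hp, hq, ⟨hf0, hs0⟩, ⟨hf1, hs1⟩⟩, -, -, -, hz⟩ := hθ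
  have hn : 0 < enormF (fun k => θ.f0 k - θ.f1 k) := lt_of_lt_of_le hζ hz
  obtain ⟨hp0, hp1⟩ := hp
  obtain ⟨hq0, hq1⟩ := hq
  have hpq : 0 < θ.p + θ.q := by linarith
  have b0 : ∀ k, θ.f0 k ≤ 1 := fun k => by
    rw [← hs0]; exact Finset.single_le_sum (fun i _ => hf0 i) (Finset.mem_univ k)
  have b1 : ∀ k, θ.f1 k ≤ 1 := fun k => by
    rw [← hs1]; exact Finset.single_le_sum (fun i _ => hf1 i) (Finset.mem_univ k)
  have hsq : enormF (fun k => θ.f0 k - θ.f1 k) ^ 2 = ∑ k, (θ.f0 k - θ.f1 k) ^ 2 :=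
    Real.sq_sqrt (Finset.sum_nonneg fun _ _ => sq_nonneg _)
  have hle2 : enormF (fun k => θ.f0 k - θ.f1 k) ^ 2 ≤ 2 := by
    rw [hsq]
    calc ∑ k, (θ.f0 k - θ.f1 k) ^ 2 ≤ ∑ k, (θ.f0 k + θ.f1 k) :=
          Finset.sum_le_sum fun k _ => by
            nlinarith [hf0 k, hf1 k, b0 k, b1 k, mul_nonneg (hf0 k) (hf1 k)]
      _ = 2 := by rw [Finset.sum_add_distrib, hs0, hs1]; norm_num
  have hphi1 : ((θ.q - θ.p) / (θ.p + θ.q)) ^ 2 ≤ 1 := by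
    rw [div_pow, div_le_one (by positivity)]
    nlinarith
  have hphi2 : |1 - θ.p - θ.q| ≤ 1 := by rw [abs_le]; constructor <;> linarith
  have hr : |rfun (phiOf θ)| ≤ 1 := by
    simp only [rfun, phiOf]
    rw [abs_div, abs_mul, abs_mul]
    set x := ((θ.q - θ.p) / (θ.p + θ.q)) ^ 2
    set e := enormF (fun k => θ.f0 k - θ.f1 k) ^ 2
    have hx : |1 - x| ≤ 1 := by
      have : 0 ≤ x := sq_nonneg _
      rw [abs_le]; constructor <;> linarith
    have he : |e| ≤ 2 := by rw [abs_of_nonneg (sq_nonneg _)]; exact hle2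
    have h12 : |1 - x| * |1 - θ.p - θ.q| ≤ 1 := mul_le_one₀ hx (abs_nonneg _) hphi2
    have : |1 - x| * |1 - θ.p - θ.q| * |e| ≤ 1 * 2 :=
      mul_le_mul h12 he (abs_nonneg _) (by norm_num)
    have h4 : |(4:ℝ)| = 4 := by norm_num
    rw [h4]; linarith
  refine ⟨?_, ?_, ?_, ?_, ?_, hr, ?_⟩
  · simp only [pack, phiOf]; linarith
  · intro a
    simp only [pack, psiOf]
    rw [abs_of_nonneg, div_le_one hpq]
    · nlinarith [b0 a, b1 a]
    · have := hf0 a; have := hf1 a; positivity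
  · simp only [pack, psiOf]
    rw [← Finset.sum_div, Finset.sum_add_distrib, ← Finset.mul_sum, ← Finset.mul_sum, hs0, hs1,
      div_eq_one_iff_eq hpq.ne']
    ring
  · simp only [pack, psiOf]
    rw [← Finset.sum_div, Finset.sum_sub_distrib, hs0, hs1]; simp
  · simp only [pack, psiOf, div_pow]
    rw [← Finset.sum_div, ← hsq]
    exact div_self (by positivity)
  · simp only [mvec, abs_mul, pack]
    exact mul_le_one₀ hphi2 (abs_nonneg _) hr

lemma abs_sum_le {K : ℕ} (F : Fin K → ℝ) (B : ℝ) (h : ∀ a, |F a| ≤ B) :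
    |∑ a, F a| ≤ K * B := by
  refine (Finset.abs_sum_le_sum_abs _ _).trans ?_
  refine (Finset.sum_le_sum fun a _ => h a).trans ?_
  simp

lemma sum_le {K : ℕ} (F : Fin K → ℝ) (B : ℝ) (h : ∀ a, F a ≤ B) :
    ∑ a, F a ≤ K * B := by
  refine (Finset.sum_le_sum fun a _ => h a).trans ?_
  simp

lemma abs_mul_le' {x y A : ℝ} (hx : |x| ≤ A) (hy : |y| ≤ 1) : |x * y| ≤ A := by
  rw [abs_mul]
  have := mul_le_mul hx hy (abs_nonneg _) ((abs_nonneg _).trans hx)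
  simpa using this

lemma frob2 {K : ℕ} (h h' : Fin K → ℝ) (x y : ℝ) (hh : ∑ a, h a ^ 2 = 1)
    (hh' : ∑ a, h' a ^ 2 = 1) :
    ∑ a, ∑ b, (x * (h a * h b) - y * (h' a * h' b)) ^ 2
      = x ^ 2 + y ^ 2 - 2 * x * y * (∑ a, h a * h' a) ^ 2 := by
  have e : ∀ a b, (x * (h a * h b) - y * (h' a * h' b)) ^ 2
      = x ^ 2 * (h a ^ 2 * h b ^ 2) + y ^ 2 * (h' a ^ 2 * h' b ^ 2)
        - 2 * x * y * ((h a * h' a) * (h b * h' b)) := fun a b => by ring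
  simp only [e, Finset.sum_add_distrib, Finset.sum_sub_distrib, ← Finset.mul_sum,
    ← Finset.sum_mul, hh, hh']
  ring

lemma frob3 {K : ℕ} (h h' : Fin K → ℝ) (x y : ℝ) (hh : ∑ a, h a ^ 2 = 1)
    (hh' : ∑ a, h' a ^ 2 = 1) :
    ∑ a, ∑ b, ∑ c, (x * (h a * h b * h c) - y * (h' a * h' b * h' c)) ^ 2
      = x ^ 2 + y ^ 2 - 2 * x * y * (∑ a, h a * h' a) ^ 3 := by
  have e : ∀ a b c, (x * (h a * h b * h c) - y * (h' a * h' b * h' c)) ^ 2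
      = x ^ 2 * (h a ^ 2 * (h b ^ 2 * h c ^ 2)) + y ^ 2 * (h' a ^ 2 * (h' b ^ 2 * h' c ^ 2))
        - 2 * x * y * ((h a * h' a) * ((h b * h' b) * (h c * h' c))) := fun a b c => by ring
  simp only [e, Finset.sum_add_distrib, Finset.sum_sub_distrib, ← Finset.mul_sum,
    ← Finset.sum_mul, hh, hh']
  ring

lemma sgn_sq (t : ℝ) : sgn t ^ 2 = 1 := by
  unfold sgn; split_ifs <;> norm_num

lemma sgn_mul_nonneg (t : ℝ) : 0 ≤ sgn t * t := by
  unfold sgn; split_ifs <;> linarith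

lemma enormF_nonneg {α : Type*} [Fintype α] (g : α → ℝ) : 0 ≤ enormF g := Real.sqrt_nonneg _

lemma le_enormF {α : Type*} [Fintype α] (g : α → ℝ) (a : α) : |g a| ≤ enormF g := by
  unfold enormF
  apply Real.abs_le_sqrt
  exact Finset.single_le_sum (f := fun a => g a ^ 2) (fun i _ => sq_nonneg _) (Finset.mem_univ a)

set_option maxHeartbeats 1600000 in
theorem statement5 (K : ℕ) (hK : 2 ≤ K) :
    ∃ c₁ : ℝ, 0 < c₁ ∧
      ∀ π ∈ PhiAll K, ∀ π' ∈ PhiAll K,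
        c₁ * rho π π' ≤ enormF (fun v => p3 π v - p3 π' v) := by
  have hk : (1 : ℝ) ≤ K := by exact_mod_cast (by omega : 1 ≤ K)
  refine ⟨1 / (32 * (K : ℝ) ^ 4), by positivity, ?_⟩
  intro π hπ π' hπ'
  obtain ⟨hd, hg1, hgs, hhs, hhn, hm1, hm2⟩ := facts π hπ
  obtain ⟨hd', hg1', hgs', hhs', hhn', hm1', hm2'⟩ := facts π' hπ'
  have ent : ∀ a b c, |p3 π ![a, b, c] - p3 π' ![a, b, c]| ≤
      enormF (fun v => p3 π v - p3 π' v) := fun a b c =>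
    le_enormF (fun v => p3 π v - p3 π' v) ![a, b, c]
  have hD0 : 0 ≤ enormF (fun v => p3 π v - p3 π' v) := enormF_nonneg _
  simp only [p3_expand π hd, p3_expand π' hd'] at ent
  rw [div_mul_eq_mul_div, one_mul, div_le_iff₀ (by positivity)]
  unfold rho
  generalize enormF (fun v => p3 π v - p3 π' v) = D at ent hD0 ⊢
  obtain ⟨φ, g, h⟩ := π
  obtain ⟨φ', g', h'⟩ := π'
  simp only at hd hg1 hgs hhs hhn hm1 hm2 hd' hg1' hgs' hhs' hhn' hm1' hm2' ent ⊢
  clear hπ hπ' hd hd'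
  generalize (mvec φ).1 = m1 at *
  generalize (mvec φ).2.1 = m2 at *
  generalize (mvec φ).2.2 = m3 at *
  generalize (mvec φ').1 = n1 at *
  generalize (mvec φ').2.1 = n2 at *
  generalize (mvec φ').2.2 = n3 at *
  have hs2 := sgn_sq (∑ k, h k * h' k)
  have hsc := sgn_mul_nonneg (∑ k, h k * h' k)
  have hF2 := fun x y => frob2 h h' x y hhn hhn'
  have hF3 := fun x y => frob3 h h' x y hhn hhn'
  have hnorm : ∑ k, (h k - sgn (∑ j, h j * h' j) * h' k) ^ 2
      = 2 - 2 * (sgn (∑ j, h j * h' j) * ∑ j, h j * h' j) := by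
    generalize sgn (∑ j, h j * h' j) = s at *
    have e : ∀ k, (h k - s * h' k) ^ 2 = h k ^ 2 + s ^ 2 * h' k ^ 2 - 2 * s * (h k * h' k) :=
      fun k => by ring
    simp only [e, Finset.sum_add_distrib, Finset.sum_sub_distrib, ← Finset.mul_sum, hhn, hhn', hs2]
    ring
  have hE2 : enormF (fun k => h k - sgn (∑ j, h j * h' j) * h' k) ^ 2
      = 2 - 2 * (sgn (∑ j, h j * h' j) * ∑ j, h j * h' j) := by
    rw [← hnorm]; exact Real.sq_sqrt (Finset.sum_nonneg fun _ _ => sq_nonneg _)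
  have hE0 := enormF_nonneg (fun k => h k - sgn (∑ j, h j * h' j) * h' k)
  generalize enormF (fun k => h k - sgn (∑ j, h j * h' j) * h' k) = E at *
  clear hnorm
  generalize sgn (∑ j, h j * h' j) = s at *
  generalize (∑ j, h j * h' j) = c at *
  have hh1 : ∀ a, |h a| ≤ 1 := fun a => by
    rw [← sq_le_one_iff_abs_le_one, ← hhn]
    exact Finset.single_le_sum (f := fun a => h a ^ 2) (fun i _ => sq_nonneg _) (Finset.mem_univ a)
  have hh1' : ∀ a, |h' a| ≤ 1 := fun a => by
    rw [← sq_le_one_iff_abs_le_one, ← hhn']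
    exact Finset.single_le_sum (f := fun a => h' a ^ 2) (fun i _ => sq_nonneg _)
      (Finset.mem_univ a)
  set k : ℝ := (K : ℝ) with hkdef
  have hkD : k * D ≤ k ^ 2 * D := by
    apply mul_le_mul_of_nonneg_right _ hD0; nlinarith
  have hD1 : D ≤ k * D := by nlinarith
  -- marginals
  have M12 : ∀ a b, |(g a * g b + m1 * (h a * h b)) - (g' a * g' b + n1 * (h' a * h' b))|
      ≤ k * D := by
    intro a b
    have := abs_sum_le _ D (ent a b)
    convert this using 2
    have e : ∀ (m1 m2 m3 : ℝ) (g h : Fin K → ℝ), ∑ c, g c = 1 → ∑ c, h c = 0 →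
        ∑ c, (g a * g b * g c + m1 * (h a * h b * g c + g a * h b * h c)
          + m2 * (h a * g b * h c) - m3 * (h a * h b * h c)) = g a * g b + m1 * (h a * h b) := by
      intro m1 m2 m3 g h hg hh
      simp only [Finset.sum_add_distrib, Finset.sum_sub_distrib, ← Finset.mul_sum, hg, hh]
      ring
    rw [Finset.sum_sub_distrib, e _ _ _ _ _ hgs hhs, e _ _ _ _ _ hgs' hhs']
  have M13 : ∀ a b, |(g a * g b + m2 * (h a * h b)) - (g' a * g' b + n2 * (h' a * h' b))|
      ≤ k * D := by
    intro a c
    have := abs_sum_le _ D (fun b => ent a b c)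
    convert this using 2
    have e : ∀ (m1 m2 m3 : ℝ) (g h : Fin K → ℝ), ∑ c, g c = 1 → ∑ c, h c = 0 →
        ∑ b, (g a * g b * g c + m1 * (h a * h b * g c + g a * h b * h c)
          + m2 * (h a * g b * h c) - m3 * (h a * h b * h c)) = g a * g c + m2 * (h a * h c) := by
      intro m1 m2 m3 g h hg hh
      simp only [Finset.sum_add_distrib, Finset.sum_sub_distrib, ← Finset.mul_sum,
        ← Finset.sum_mul, hg, hh]
      ring
    rw [Finset.sum_sub_distrib, e _ _ _ _ _ hgs hhs, e _ _ _ _ _ hgs' hhs']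
  have M1 : ∀ a, |g a - g' a| ≤ k ^ 2 * D := by
    intro a
    have := abs_sum_le _ (k * D) (M12 a)
    rw [← hkdef, ← mul_assoc, ← sq] at this
    convert this using 2
    have e : ∀ (m1 : ℝ) (g h : Fin K → ℝ), ∑ c, g c = 1 → ∑ c, h c = 0 →
        ∑ b, (g a * g b + m1 * (h a * h b)) = g a := by
      intro m1 g h hg hh
      simp only [Finset.sum_add_distrib, ← Finset.mul_sum, hg, hh]
      ring
    rw [Finset.sum_sub_distrib, e _ _ _ hgs hhs, e _ _ _ hgs' hhs']
  have Mgg : ∀ a b, |g a * g b - g' a * g' b| ≤ 2 * (k ^ 2 * D) := by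
    intro a b
    have e : g a * g b - g' a * g' b = (g a - g' a) * g b + (g b - g' b) * g' a := by ring
    rw [e]
    refine (abs_add_le _ _).trans ?_
    have := abs_mul_le' (M1 a) (hg1 b)
    have := abs_mul_le' (M1 b) (hg1' a)
    linarith
  have Mggg : ∀ a b c, |g a * g b * g c - g' a * g' b * g' c| ≤ 3 * (k ^ 2 * D) := by
    intro a b c
    have e : g a * g b * g c - g' a * g' b * g' c
      = (g a * g b - g' a * g' b) * g c + (g c - g' c) * g' a * g' b := by ring
    rw [e]
    refine (abs_add_le _ _).trans ?_
    have := abs_mul_le' (Mgg a b) (hg1 c)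
    have := abs_mul_le' (abs_mul_le' (M1 c) (hg1' a)) (hg1' b)
    linarith
  have key : ∀ m n : ℝ, |n| ≤ 1 →
      (∀ a b, |(g a * g b + m * (h a * h b)) - (g' a * g' b + n * (h' a * h' b))| ≤ k * D) →
      (∀ a b, |m * (h a * h b) - n * (h' a * h' b)| ≤ 3 * (k ^ 2 * D)) ∧
      (∀ a b c, |m * (h a * h b) * g c - n * (h' a * h' b) * g' c| ≤ 4 * (k ^ 2 * D)) := by
    intro m n hn H
    have H1 : ∀ a b, |m * (h a * h b) - n * (h' a * h' b)| ≤ 3 * (k ^ 2 * D) := by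
      intro a b
      have h1 := abs_le.1 (H a b)
      have h2 := abs_le.1 (Mgg a b)
      rw [abs_le]
      constructor <;> linarith [h1.1, h1.2, h2.1, h2.2]
    refine ⟨H1, fun a b c => ?_⟩
    have e : m * (h a * h b) * g c - n * (h' a * h' b) * g' c
      = (m * (h a * h b) - n * (h' a * h' b)) * g c + (g c - g' c) * n * h' a * h' b := by ring
    rw [e]
    refine (abs_add_le _ _).trans ?_
    have := abs_mul_le' (H1 a b) (hg1 c)
    have := abs_mul_le' (abs_mul_le' (abs_mul_le' (M1 c) hn) (hh1' a)) (hh1' b)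
    linarith
  obtain ⟨A1, B1⟩ := key m1 n1 hm1' M12
  obtain ⟨A2, B2⟩ := key m2 n2 hm2' M13
  have A3 : ∀ a b c, |m3 * (h a * h b * h c) - n3 * (h' a * h' b * h' c)|
      ≤ 16 * (k ^ 2 * D) := by
    intro a b c
    have h0 := abs_le.1 (ent a b c)
    have h1 := abs_le.1 (Mggg a b c)
    have h2 := abs_le.1 (B1 a b c)
    have h3 := abs_le.1 (B1 b c a)
    have h4 := abs_le.1 (B2 a c b)
    rw [abs_le]
    constructor <;> nlinarith [h0.1, h0.2, h1.1, h1.2, h2.1, h2.2, h3.1, h3.2, h4.1, h4.2]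
  -- final bounds
  have tr : ∀ m n : ℝ, (∀ a b, |m * (h a * h b) - n * (h' a * h' b)| ≤ 3 * (k ^ 2 * D)) →
      |m - n| ≤ 3 * (k ^ 3 * D) := by
    intro m n H
    have := abs_sum_le _ _ (fun a => H a a)
    rw [← hkdef] at this
    calc |m - n| = |∑ a, (m * (h a * h a) - n * (h' a * h' a))| := by
          simp only [← sq, Finset.sum_sub_distrib, ← Finset.mul_sum, hhn, hhn', mul_one]
      _ ≤ _ := this
      _ = _ := by ring
  have hk3 : k ^ 3 * D ≤ k ^ 4 * D := by
    apply mul_le_mul_of_nonneg_right _ hD0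
    exact pow_le_pow_right₀ hk (by norm_num)
  have hk30 : 0 ≤ k ^ 3 * D := by positivity
  have hk40 : 0 ≤ k ^ 4 * D := by positivity
  have hc1 : s * c ≤ 1 := by nlinarith [sq_nonneg E]
  have fro : m1 ^ 2 + n1 ^ 2 - 2 * m1 * n1 * c ^ 2 ≤ (3 * (k ^ 3 * D)) ^ 2 := by
    rw [← hF2 m1 n1]
    calc _ ≤ k * (k * (3 * (k ^ 2 * D)) ^ 2) := by
          refine sum_le _ _ fun a => sum_le _ _ fun b => ?_
          rw [← sq_abs]
          exact pow_le_pow_left₀ (abs_nonneg _) (A1 a b) 2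
      _ = _ := by ring
  have fro3 : m3 ^ 2 + n3 ^ 2 - 2 * m3 * n3 * c ^ 3 ≤ (16 * (k ^ 4 * D)) ^ 2 := by
    rw [← hF3 m3 n3]
    calc _ ≤ k * (k * (k * (16 * (k ^ 2 * D)) ^ 2)) := by
          refine sum_le _ _ fun a => sum_le _ _ fun b => sum_le _ _ fun c => ?_
          rw [← sq_abs]
          exact pow_le_pow_left₀ (abs_nonneg _) (A3 a b c) 2
      _ = k ^ 7 * (16 ^ 2 * D ^ 2) := by ring
      _ ≤ k ^ 8 * (16 ^ 2 * D ^ 2) := by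
          apply mul_le_mul_of_nonneg_right _ (by positivity)
          exact pow_le_pow_right₀ hk (by norm_num)
      _ = _ := by ring
  obtain ⟨t, ht⟩ : ∃ t, t = s * c := ⟨_, rfl⟩
  rw [← ht] at hsc hc1 hE2
  have hc2 : c ^ 2 = t ^ 2 := by rw [ht, mul_pow, hs2, one_mul]
  have hc3 : c ^ 3 = s * t ^ 3 := by
    rw [ht]
    have : s * (s * c) ^ 3 = (s ^ 2) ^ 2 * c ^ 3 := by ring
    rw [this, hs2]; ring
  rw [hc2] at fro
  rw [hc3] at fro3
  have ht4 : t ^ 4 ≤ t := by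
    have := pow_le_pow_of_le_one hsc hc1 (by norm_num : 1 ≤ 4)
    rwa [pow_one] at this
  have final5 : ∀ x y : ℝ, x ^ 2 + y ^ 2 - 2 * x * y * t ^ 2 ≤ (3 * (k ^ 3 * D)) ^ 2 →
      |x| * E ≤ 6 * (k ^ 3 * D) := by
    intro x y H
    apply abs_le_of_sq_le_sq' _ (by positivity) |>.2
    rw [mul_pow, sq_abs, hE2]
    have : x ^ 2 * (1 - t) ≤ x ^ 2 * (1 - t ^ 4) :=
      mul_le_mul_of_nonneg_left (by linarith) (sq_nonneg _)
    nlinarith [sq_nonneg (y - x * t ^ 2), sq_nonneg (k ^ 3 * D)]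
  have f5 := final5 m1 n1 fro
  have f5' := final5 n1 m1 (by linarith)
  have f4 : enormF (fun k => g k - g' k) ≤ k ^ 3 * D := by
    unfold enormF
    apply Real.sqrt_le_iff.2 ⟨hk30, ?_⟩
    calc _ ≤ k * (k ^ 2 * D) ^ 2 := by
          refine sum_le _ _ fun a => ?_
          rw [← sq_abs]
          exact pow_le_pow_left₀ (abs_nonneg _) (M1 a) 2
      _ = k ^ 5 * D ^ 2 := by ring
      _ ≤ k ^ 6 * D ^ 2 := by
          apply mul_le_mul_of_nonneg_right _ (by positivity)
          exact pow_le_pow_right₀ hk (by norm_num)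
      _ = _ := by ring
  have f3 : |m3 - s * n3| ≤ 32 * (k ^ 4 * D) := by
    apply abs_le_of_sq_le_sq _ (by positivity)
    have hn : n3 ^ 2 = (s * n3) ^ 2 := by rw [mul_pow, hs2, one_mul]
    have e : 2 * m3 * n3 * (s * t ^ 3) = 2 * m3 * (s * n3) * t ^ 3 := by ring
    rw [hn, e] at fro3
    generalize s * n3 = y at *
    have ht30 : 0 ≤ t ^ 3 := by positivity
    have ht31 : t ^ 3 ≤ 1 := pow_le_one₀ hsc hc1
    have : (m3 - y) ^ 2 ≤ 2 * (m3 ^ 2 + y ^ 2 - 2 * m3 * y * t ^ 3) := by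
      nlinarith [mul_nonneg ht30 (sq_nonneg (m3 - y)),
        mul_nonneg (sub_nonneg.2 ht31) (sq_nonneg (m3 + y)),
        mul_nonneg (sub_nonneg.2 ht31) (sq_nonneg (m3 - y)), sq_nonneg (m3 - y)]
    nlinarith [sq_nonneg (k ^ 4 * D)]
  have f1 := tr m1 n1 A1
  have f2 := tr m2 n2 A2
  have goalEq : D * (32 * k ^ 4) = 32 * (k ^ 4 * D) := by ring
  rw [goalEq]
  refine max_le (max_le (max_le (max_le ?_ ?_) f3) ?_) ?_
  · linarith
  · linarith
  · linarith
  · rw [max_mul_of_nonneg _ _ hE0]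
    exact max_le (by linarith) (by linarith)

end PaperHMM
end

section
/- Let θ=θ(φ,ψ) and θ̃=θ(φ̃,ψ̃) be HMM parameters whose emission densities satisfy min(f₀,f₁,f̃₀,f̃₁) ≥ c pointwise for some c∈(0,1). There exist constants C>0 and ε₀>0 depending only on c such that if max(|φ₂|,|φ̃₂|) ≤ ε₀, then for every n, the Kullback–Leibler divergence satisfies K(P_θ^{(n)} ; P_{θ̃}^{(n)}) ≤ C·n·ρ((φ,ψ);(φ̃,ψ̃))². -/
open scoped BigOperators

namespace PaperHMM

/-- One step of the normalised predictive recursion. -/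
noncomputable def stepT (r α β a b t : ℝ) : ℝ :=
  (α * t * a + (1 - β * t) * b) / (a + r * t * b)

/-- The normalised predictive filter. -/
noncomputable def tS {K : ℕ} (r α β : ℝ) (u v : Fin K → ℝ) : (n : ℕ) → (Fin n → Fin K) → ℝ
  | 0, _ => 0
  | n + 1, y => stepT r α β (u (y (Fin.last n))) (v (y (Fin.last n))) (tS r α β u v n (Fin.init y))

/-- The law as a product of predictive densities. -/
noncomputable def PR {K : ℕ} (r α β : ℝ) (u v : Fin K → ℝ) : (n : ℕ) → (Fin n → Fin K) → ℝ
  | 0, _ => 1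
  | n + 1, y => PR r α β u v n (Fin.init y) *
      (u (y (Fin.last n)) + r * tS r α β u v n (Fin.init y) * v (y (Fin.last n)))

/-- Weight of a hidden path. -/
noncomputable def wt {K : ℕ} (θ : Param K) (n : ℕ) (x : Fin n → Fin 2) (y : Fin n → Fin K) : ℝ :=
    (∏ i : Fin n,
        (if (i : ℕ) = 0 then initD θ (x i)
          else transP θ (x ⟨(i : ℕ) - 1, lt_of_le_of_lt (Nat.sub_le _ _) i.isLt⟩) (x i)))
      * ∏ i : Fin n, emit θ (x i) (y i)

/-- Law of the next hidden state. -/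
noncomputable def nxt {K : ℕ} (θ : Param K) (n : ℕ) (x : Fin n → Fin 2) (b : Fin 2) : ℝ :=
  if h : n = 0 then initD θ b else transP θ (x ⟨n - 1, by omega⟩) b

/-- Forward quantity. -/
noncomputable def fwd {K : ℕ} (θ : Param K) (n : ℕ) (y : Fin n → Fin K) (b : Fin 2) : ℝ :=
  ∑ x : Fin n → Fin 2, wt θ n x y * nxt θ n x b

lemma wt_snoc {K : ℕ} (θ : Param K) (n : ℕ) (x : Fin n → Fin 2) (a : Fin 2)
    (y : Fin (n + 1) → Fin K) :
    wt θ (n + 1) (Fin.snoc x a : Fin (n + 1) → Fin 2) y =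
      wt θ n x (Fin.init y) * nxt θ n x a * emit θ a (y (Fin.last n)) := by
  have key : ∀ (m : ℕ) (hm : m < n) (hm' : m < n + 1),
      (Fin.snoc x a : Fin (n + 1) → Fin 2) ⟨m, hm'⟩ = x ⟨m, hm⟩ := by
    intro m hm hm'
    exact Fin.snoc_castSucc (α := fun _ => Fin 2) a x ⟨m, hm⟩
  unfold wt
  rw [Fin.prod_univ_castSucc, Fin.prod_univ_castSucc]
  have h1 : ∀ i : Fin n, (if ((Fin.castSucc i : Fin (n+1)) : ℕ) = 0 then
      initD θ ((Fin.snoc x a : Fin (n + 1) → Fin 2) (Fin.castSucc i))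
      else transP θ ((Fin.snoc x a : Fin (n + 1) → Fin 2) ⟨((Fin.castSucc i : Fin (n+1)) : ℕ) - 1,
        lt_of_le_of_lt (Nat.sub_le _ _) (Fin.castSucc i).isLt⟩)
        ((Fin.snoc x a : Fin (n + 1) → Fin 2) (Fin.castSucc i)))
      = (if (i : ℕ) = 0 then initD θ (x i)
          else transP θ (x ⟨(i : ℕ) - 1, lt_of_le_of_lt (Nat.sub_le _ _) i.isLt⟩) (x i)) := by
    intro i
    rw [Fin.snoc_castSucc (α := fun _ => Fin 2)]
    have h2 := key ((i : ℕ) - 1) (lt_of_le_of_lt (Nat.sub_le _ _) i.isLt)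
      (lt_of_le_of_lt (Nat.sub_le _ _) (Fin.castSucc i).isLt)
    simp only [Fin.val_castSucc]
    rw [h2]
  have h3 : (if ((Fin.last n : Fin (n+1)) : ℕ) = 0 then
      initD θ ((Fin.snoc x a : Fin (n + 1) → Fin 2) (Fin.last n))
      else transP θ ((Fin.snoc x a : Fin (n + 1) → Fin 2) ⟨((Fin.last n : Fin (n+1)) : ℕ) - 1,
        lt_of_le_of_lt (Nat.sub_le _ _) (Fin.last n).isLt⟩)
        ((Fin.snoc x a : Fin (n + 1) → Fin 2) (Fin.last n)))
      = nxt θ n x a := by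
    rw [Fin.snoc_last (α := fun _ => Fin 2)]
    unfold nxt
    simp only [Fin.val_last]
    by_cases h : n = 0
    · simp [h]
    · simp only [h, if_false, dif_neg, not_false_iff]
      rw [key (n - 1) (by omega)]
  rw [Finset.prod_congr rfl (fun i _ => h1 i), h3]
  simp only [Fin.snoc_castSucc (α := fun _ => Fin 2), Fin.snoc_last (α := fun _ => Fin 2)]
  simp only [Fin.init]
  ring

lemma sum_snoc_s7 {X : Type*} [Fintype X] (n : ℕ) (f : (Fin (n + 1) → X) → ℝ) :
    ∑ x, f x = ∑ x : Fin n → X, ∑ a : X, f (Fin.snoc x a : Fin (n + 1) → X) := by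
  rw [← (Fin.snocEquiv (fun _ : Fin (n + 1) => X)).sum_comp, Fintype.sum_prod_type,
    Finset.sum_comm]
  rfl

lemma fwd_succ {K : ℕ} (θ : Param K) (n : ℕ) (y : Fin (n + 1) → Fin K) (b : Fin 2) :
    fwd θ (n + 1) y b = fwd θ n (Fin.init y) 0 * θ.f0 (y (Fin.last n)) * transP θ 0 b
      + fwd θ n (Fin.init y) 1 * θ.f1 (y (Fin.last n)) * transP θ 1 b := by
  have hn : ∀ (x : Fin n → Fin 2) (a : Fin 2),
      nxt θ (n + 1) (Fin.snoc x a : Fin (n + 1) → Fin 2) b = transP θ a b := by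
    intro x a
    have : (Fin.snoc x a : Fin (n + 1) → Fin 2) ⟨n + 1 - 1, by omega⟩ = a :=
      Fin.snoc_last (α := fun _ => Fin 2) a x
    unfold nxt
    rw [dif_neg (by omega), this]
  unfold fwd
  rw [sum_snoc_s7]
  simp only [wt_snoc, hn, Fin.sum_univ_two]
  rw [Finset.sum_add_distrib]
  simp only [Finset.sum_mul]
  simp [emit]

lemma pLaw_eq_fwd {K : ℕ} (θ : Param K) (h : θ.p + θ.q ≠ 0) (n : ℕ) (y : Fin n → Fin K) :
    pLaw θ n y = fwd θ n y 0 + fwd θ n y 1 := by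
  unfold fwd
  rw [← Finset.sum_add_distrib]
  unfold pLaw
  refine Finset.sum_congr rfl fun x _ => ?_
  have h1 : nxt θ n x 0 + nxt θ n x 1 = 1 := by
    unfold nxt
    split_ifs with h0
    · simp only [initD]
      simp
      field_simp
      ring
    · unfold transP
      split_ifs <;> simp_all
  rw [← mul_add, h1, mul_one]
  rfl

lemma fwd_eq {K : ℕ} (π : PP K) (s : ℝ) (hs : s = 1 ∨ s = -1) (h2 : π.1.2.1 ≠ 1)
    (hD : ∀ n (y : Fin n → Fin K) k, π.2.1 k + rfun π.1 *
      tS (rfun π.1) π.1.2.1 (s * (π.1.1 * π.1.2.1 * π.1.2.2)) π.2.1 (fun k => s * π.2.2 k) n y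
        * (s * π.2.2 k) ≠ 0) (n : ℕ) (y : Fin n → Fin K) :
    fwd (unpack π) n y 0 =
      PR (rfun π.1) π.1.2.1 (s * (π.1.1 * π.1.2.1 * π.1.2.2)) π.2.1 (fun k => s * π.2.2 k) n y *
      ((1 + π.1.1) / 2 + π.1.2.1 * ((1 - π.1.1 ^ 2) / 4) * π.1.2.2 * s *
        tS (rfun π.1) π.1.2.1 (s * (π.1.1 * π.1.2.1 * π.1.2.2)) π.2.1 (fun k => s * π.2.2 k) n y)
    ∧ fwd (unpack π) n y 1 =
      PR (rfun π.1) π.1.2.1 (s * (π.1.1 * π.1.2.1 * π.1.2.2)) π.2.1 (fun k => s * π.2.2 k) n y *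
      ((1 - π.1.1) / 2 - π.1.2.1 * ((1 - π.1.1 ^ 2) / 4) * π.1.2.2 * s *
        tS (rfun π.1) π.1.2.1 (s * (π.1.1 * π.1.2.1 * π.1.2.2)) π.2.1 (fun k => s * π.2.2 k) n y)
    := by
  have h2' : 1 - π.1.2.1 ≠ 0 := fun h => h2 (by linarith)
  have hpq : (unpack π).p + (unpack π).q = 1 - π.1.2.1 := by simp only [unpack]; ring
  have hss : s * s = 1 := by rcases hs with h | h <;> rw [h] <;> norm_num
  induction n with
  | zero =>
    simp only [fwd, tS, PR, wt, nxt, initD, hpq]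
    simp only [unpack]
    constructor <;> simp <;> field_simp
  | succ n ih =>
    obtain ⟨ih0, ih1⟩ := ih (Fin.init y)
    rw [fwd_succ, fwd_succ, ih0, ih1]
    simp only [tS, PR, stepT]
    have hd := hD n (Fin.init y) (y (Fin.last n))
    generalize tS (rfun π.1) π.1.2.1 (s * (π.1.1 * π.1.2.1 * π.1.2.2)) π.2.1
      (fun k => s * π.2.2 k) n (Fin.init y) = t at *
    generalize PR (rfun π.1) π.1.2.1 (s * (π.1.1 * π.1.2.1 * π.1.2.2)) π.2.1
      (fun k => s * π.2.2 k) n (Fin.init y) = P at *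
    simp only [transP, unpack]
    generalize π.2.1 (y (Fin.last n)) = a at *
    generalize π.2.2 (y (Fin.last n)) = b at *
    set d := a + rfun π.1 * t * (s * b) with hdd
    have e : d = a + (1 - π.1.1 ^ 2) * π.1.2.1 * π.1.2.2 ^ 2 / 4 * t * (s * b) := hdd
    clear_value d
    generalize π.1.1 = x at *
    generalize π.1.2.1 = z at *
    generalize π.1.2.2 = w at *
    have e2 : ∀ A B C D : ℝ, P * d * (A + B * (C / d)) = P * (A * d + B * C) := by
      intro A B C D; field_simp
    have e3 : ∀ A B C D : ℝ, P * d * (A - B * (C / d)) = P * (A * d - B * C) := by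
      intro A B C D; field_simp
    rw [e2 _ _ _ 0, e3 _ _ _ 0, e]
    rcases hs with rfl | rfl
    · constructor <;> simp <;> ring
    · constructor <;> simp <;> ring

lemma pLaw_eq_PR {K : ℕ} (π : PP K) (s : ℝ) (hs : s = 1 ∨ s = -1) (h2 : π.1.2.1 ≠ 1)
    (hD : ∀ n (y : Fin n → Fin K) k, π.2.1 k + rfun π.1 *
      tS (rfun π.1) π.1.2.1 (s * (π.1.1 * π.1.2.1 * π.1.2.2)) π.2.1 (fun k => s * π.2.2 k) n y
        * (s * π.2.2 k) ≠ 0) (n : ℕ) (y : Fin n → Fin K) :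
    pLaw (unpack π) n y =
      PR (rfun π.1) π.1.2.1 (s * (π.1.1 * π.1.2.1 * π.1.2.2)) π.2.1 (fun k => s * π.2.2 k) n y := by
  have hpq : (unpack π).p + (unpack π).q = 1 - π.1.2.1 := by simp only [unpack]; ring
  rw [pLaw_eq_fwd _ (by rw [hpq]; intro h; exact h2 (by linarith)), (fwd_eq π s hs h2 hD n y).1,
    (fwd_eq π s hs h2 hD n y).2]
  ring

/-- Pointwise bounds on the coefficients, `T = 4 / c`. -/
structure Good_s7 {K : ℕ} (c ε r α β : ℝ) (u v : Fin K → ℝ) : Prop where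
  hr : |r| ≤ ε / 2
  ha : |α| ≤ ε
  hb : |β| ≤ 2 * ε
  hu : ∀ k, c ≤ u k
  hu1 : ∀ k, u k ≤ 1
  hv : ∀ k, |v k| ≤ 1

lemma den_bound {K : ℕ} {c ε r α β : ℝ} {u v : Fin K → ℝ} (hc : 0 < c) (hc1 : c < 1)
    (hε : ε = c ^ 2 / 100) (G : Good_s7 c ε r α β u v) {t : ℝ} (ht : |t| ≤ 4 / c) (k : Fin K) :
    c / 2 ≤ u k + r * t * v k := by
  have h1 : |r * t * v k| ≤ ε / 2 * (4 / c) * 1 := by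
    rw [abs_mul, abs_mul]
    have := G.hr; have := G.hv k
    have : 0 ≤ ε := by rw [hε]; positivity
    gcongr
  have h2 : ε / 2 * (4 / c) * 1 = c / 50 := by rw [hε]; field_simp; norm_num
  have := neg_abs_le (r * t * v k)
  have := G.hu k
  linarith

lemma step_bound {K : ℕ} {c ε r α β : ℝ} {u v : Fin K → ℝ} (hc : 0 < c) (hc1 : c < 1)
    (hε : ε = c ^ 2 / 100) (G : Good_s7 c ε r α β u v) {t : ℝ} (ht : |t| ≤ 4 / c) (k : Fin K) :
    |stepT r α β (u k) (v k) t| ≤ 4 / c := by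
  have hd := den_bound hc hc1 hε G ht k
  have hε0 : 0 ≤ ε := by rw [hε]; positivity
  unfold stepT
  rw [abs_div, abs_of_pos (by linarith : 0 < u k + r * t * v k), div_le_iff₀ (by linarith)]
  have hu : |u k| ≤ 1 := abs_le.2 ⟨by linarith [G.hu k], G.hu1 k⟩
  have hv := G.hv k
  have h1 : |α * t * u k| ≤ ε * (4 / c) * 1 := by
    rw [abs_mul, abs_mul]; have := G.ha; gcongr
  have h2 : |β * t * v k| ≤ 2 * ε * (4 / c) * 1 := by
    rw [abs_mul, abs_mul]; have := G.hb; gcongr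
  have h3 : |α * t * u k + (1 - β * t) * v k| ≤ |α * t * u k| + |v k| + |β * t * v k| := by
    have : α * t * u k + (1 - β * t) * v k = α * t * u k + v k - β * t * v k := by ring
    rw [this]
    exact (abs_sub _ _).trans (by linarith [abs_add_le (α * t * u k) (v k)])
  have h4 : ε * (4 / c) = c / 25 := by rw [hε]; field_simp; norm_num
  have h5 : 4 / c * (c / 2) ≤ 4 / c * (u k + r * t * v k) := by gcongr
  have h6 : 4 / c * (c / 2) = 2 := by field_simp; norm_num
  nlinarith

lemma tS_bound {K : ℕ} {c ε r α β : ℝ} {u v : Fin K → ℝ} (hc : 0 < c) (hc1 : c < 1)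
    (hε : ε = c ^ 2 / 100) (G : Good_s7 c ε r α β u v) (n : ℕ) (y : Fin n → Fin K) :
    |tS r α β u v n y| ≤ 4 / c := by
  induction n with
  | zero => simp only [tS, abs_zero]; positivity
  | succ n ih => exact step_bound hc hc1 hε G (ih _) _

/-- Closeness of two sets of coefficients. -/
structure Close {K : ℕ} (ρ r α β : ℝ) (u v : Fin K → ℝ) (r' α' β' : ℝ) (u' v' : Fin K → ℝ) :
    Prop where
  h0 : 0 ≤ ρ
  h1 : |r - r'| ≤ ρ
  h2 : |r * α - r' * α'| ≤ ρ
  h3 : |r * β - r' * β'| ≤ ρ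
  h4 : ∑ k, (u k - u' k) ^ 2 ≤ ρ ^ 2
  h5 : r ^ 2 * ∑ k, (v k - v' k) ^ 2 ≤ ρ ^ 2
  h6 : r' ^ 2 * ∑ k, (v k - v' k) ^ 2 ≤ ρ ^ 2
  h7 : ∑ k, (v k) ^ 2 = 1

lemma abs7 (a b c d e f g : ℝ) :
    |a + b + c + d - e - f - g| ≤ |a| + |b| + |c| + |d| + |e| + |f| + |g| := by
  have h1 := abs_sub (a + b + c + d - e - f) g
  have h2 := abs_sub (a + b + c + d - e) f
  have h3 := abs_sub (a + b + c + d) e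
  have h4 := abs_add_le (a + b + c) d
  have h5 := abs_add_le (a + b) c
  have h6 := abs_add_le a b
  linarith

lemma contraction {ρ T ε c r α β a b t r' α' β' a' b' t' d d' E : ℝ}
    (hρ : 0 ≤ ρ) (hc : 0 < c) (hc1 : c < 1) (hε : ε = c ^ 2 / 100) (hT : T = 4 / c)
    (hr : |r| ≤ ε / 2) (hα' : |α'| ≤ ε) (hβ' : |β'| ≤ 2 * ε)
    (ha : |a| ≤ 1) (hb : |b| ≤ 1) (ht : |t| ≤ T) (ht' : |t'| ≤ T)
    (h1 : |r - r'| ≤ ρ) (h2 : |r * α - r' * α'| ≤ ρ) (h3 : |r * β - r' * β'| ≤ ρ)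
    (h4 : |a - a'| ≤ ρ) (h5 : |r * (b - b')| ≤ ρ) (h6 : |r' * (b - b')| ≤ ρ)
    (hd : d = a + r * t * b) (hd' : d' = a' + r' * t' * b') (hdc : c / 2 ≤ d) (hdc' : c / 2 ≤ d')
    (hs' : |stepT r' α' β' a' b' t'| ≤ T) (hE : |r * (t - t')| ≤ E) :
    |r * (stepT r α β a b t - stepT r' α' β' a' b' t')| ≤ 4 * T ^ 2 * ρ + E / 2 := by
  have hT4 : 4 < T := by rw [hT, lt_div_iff₀ hc]; linarith
  have hε0 : 0 < ε := by rw [hε]; positivity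
  have hεT : ε * T = c / 25 := by rw [hε, hT]; field_simp; norm_num
  have hcT : c * T = 4 := by rw [hT]; field_simp
  have hcc : c ^ 2 ≤ c := by rw [pow_two]; exact mul_le_of_le_one_left hc.le hc1.le
  have hε1 : ε ≤ 1 / 100 := by rw [hε]; linarith
  have hE0 : 0 ≤ E := (abs_nonneg _).trans hE
  -- numerator
  have n1 : |(r * α - r' * α' - α' * (r - r')) * t * a| ≤ (ρ + ε * ρ) * T * 1 := by
    rw [abs_mul, abs_mul]
    have : |r * α - r' * α' - α' * (r - r')| ≤ ρ + ε * ρ := by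
      refine (abs_sub _ _).trans ?_
      rw [abs_mul]; gcongr
    gcongr
  have n2 : |α' * (r * (t - t')) * a| ≤ ε * E * 1 := by
    rw [abs_mul, abs_mul]; gcongr
  have n3 : |r * (α' * t' * (a - a'))| ≤ ε / 2 * (ε * T * ρ) := by
    rw [abs_mul, abs_mul, abs_mul]; gcongr
  have n4 : |(r * β - r' * β' - β' * (r - r')) * t * b| ≤ (ρ + 2 * ε * ρ) * T * 1 := by
    rw [abs_mul, abs_mul]
    have : |r * β - r' * β' - β' * (r - r')| ≤ ρ + 2 * ε * ρ := by
      refine (abs_sub _ _).trans ?_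
      rw [abs_mul]; gcongr
    gcongr
  have n5 : |β' * (r * (t - t')) * b| ≤ 2 * ε * E * 1 := by
    rw [abs_mul, abs_mul]; gcongr
  have n6 : |β' * t' * (r * (b - b'))| ≤ 2 * ε * T * ρ := by
    rw [abs_mul, abs_mul]; gcongr
  have hN : |r * ((α * t * a + (1 - β * t) * b) - (α' * t' * a' + (1 - β' * t') * b'))|
      ≤ 6 * T * ρ + 3 * ε * E := by
    have e : r * ((α * t * a + (1 - β * t) * b) - (α' * t' * a' + (1 - β' * t') * b'))
      = (r * α - r' * α' - α' * (r - r')) * t * a + α' * (r * (t - t')) * a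
        + r * (α' * t' * (a - a')) + r * (b - b')
        - (r * β - r' * β' - β' * (r - r')) * t * b - β' * (r * (t - t')) * b
        - β' * t' * (r * (b - b')) := by ring
    rw [e]
    have hTρ : 0 ≤ T * ρ := by positivity
    have hp1 : ε * (T * ρ) ≤ 1 / 100 * (T * ρ) := by gcongr
    have hp2 : ε * (ε * (T * ρ)) ≤ 1 / 100 * (1 / 100 * (T * ρ)) := by gcongr
    have hp3 : 4 * ρ ≤ T * ρ := by gcongr
    refine (abs7 _ _ _ _ _ _ _).trans ?_
    refine (add_le_add (add_le_add (add_le_add (add_le_add (add_le_add (add_le_add n1 n2) n3) h5)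
      n4) n5) n6).trans ?_
    have hp4 : ε / 2 * (ε * T * ρ) = ε * (ε * (T * ρ)) / 2 := by ring
    rw [hp4]
    linarith
  have m1 : |r * (t - t') * b| ≤ E * 1 := by rw [abs_mul]; gcongr
  have m2 : |(r - r') * t' * b| ≤ ρ * T * 1 := by rw [abs_mul, abs_mul]; gcongr
  have m3 : |t' * (r' * (b - b'))| ≤ T * ρ := by rw [abs_mul]; gcongr
  have hDD : |d' - d| ≤ 3 * T * ρ + E := by
    have e : d' - d = -((a - a') + r * (t - t') * b + (r - r') * t' * b
      + t' * (r' * (b - b'))) := by rw [hd, hd']; ring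
    rw [e, abs_neg]
    have hp3 : 4 * ρ ≤ T * ρ := by gcongr
    rw [abs_le] at h4 m1 m2 m3 ⊢
    constructor <;> linarith
  have hd0 : 0 < d := by linarith
  have hd0' : 0 < d' := by linarith
  have key : r * (stepT r α β a b t - stepT r' α' β' a' b' t') =
      (r * ((α * t * a + (1 - β * t) * b) - (α' * t' * a' + (1 - β' * t') * b'))
        + r * stepT r' α' β' a' b' t' * (d' - d)) / d := by
    have hs : stepT r α β a b t * d = α * t * a + (1 - β * t) * b := by
      unfold stepT; rw [← hd]; field_simp
    have hs2 : stepT r' α' β' a' b' t' * d' = α' * t' * a' + (1 - β' * t') * b' := by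
      unfold stepT; rw [← hd']; field_simp
    rw [eq_div_iff hd0.ne', ← hs, ← hs2]; ring
  rw [key, abs_div, abs_of_pos hd0, div_le_iff₀ hd0]
  have q1 : |r * stepT r' α' β' a' b' t' * (d' - d)| ≤ ε / 2 * T * (3 * T * ρ + E) := by
    rw [abs_mul, abs_mul]; gcongr
  have q2 := (abs_add_le (r * ((α * t * a + (1 - β * t) * b) - (α' * t' * a' + (1 - β' * t') * b')))
    (r * stepT r' α' β' a' b' t' * (d' - d))).trans (add_le_add hN q1)
  refine q2.trans ?_
  have q3 : (4 * T ^ 2 * ρ + E / 2) * (c / 2) ≤ (4 * T ^ 2 * ρ + E / 2) * d := by gcongr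
  refine le_trans ?_ q3
  have r1 : (4 * T ^ 2 * ρ + E / 2) * (c / 2) = 8 * T * ρ + E * c / 4 := by
    linear_combination (2 * T * ρ) * hcT
  have r2 : ε / 2 * T * (3 * T * ρ + E) = 3 * c * T * ρ / 50 + c * E / 50 := by
    linear_combination (3 * T * ρ + E) / 2 * hεT
  rw [r1, r2, mul_assoc 3 c T, hcT]
  have r3 : 4 * ρ ≤ T * ρ := by gcongr
  have r4 : ε ≤ c / 100 := by rw [hε]; linarith
  have r5 : ε * E ≤ c / 100 * E := by gcongr
  have r6 := mul_nonneg hc.le hE0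
  linarith

lemma abs_le_of_sum {K : ℕ} (f : Fin K → ℝ) {ρ : ℝ} (hρ : 0 ≤ ρ) (h : ∑ k, f k ^ 2 ≤ ρ ^ 2)
    (k : Fin K) : |f k| ≤ ρ := by
  refine abs_le_of_sq_le_sq ?_ hρ
  exact (Finset.single_le_sum (f := fun k => f k ^ 2) (fun _ _ => sq_nonneg _)
    (Finset.mem_univ k)).trans h

lemma err_bound {K : ℕ} {ρ c ε r α β r' α' β' : ℝ} {u v u' v' : Fin K → ℝ}
    (hc : 0 < c) (hc1 : c < 1) (hε : ε = c ^ 2 / 100)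
    (G : Good_s7 c ε r α β u v) (G' : Good_s7 c ε r' α' β' u' v')
    (H : Close ρ r α β u v r' α' β' u' v') (n : ℕ) (y : Fin n → Fin K) :
    |r * (tS r α β u v n y - tS r' α' β' u' v' n y)| ≤ 8 * (4 / c) ^ 2 * ρ := by
  induction n with
  | zero => simp only [tS]; simp; have := H.h0; positivity
  | succ n ih =>
    have ht := tS_bound hc hc1 hε G n (Fin.init y)
    have ht' := tS_bound hc hc1 hε G' n (Fin.init y)
    set k := y (Fin.last n) with hk
    have := contraction (c := c) (T := 4 / c) (ε := ε) (a := u k) (b := v k) (a' := u' k)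
      (b' := v' k) H.h0 hc hc1 hε rfl G.hr G'.ha G'.hb
      (abs_le.2 ⟨by linarith [G.hu k], G.hu1 k⟩) (G.hv k) ht ht' H.h1 H.h2 H.h3
      (abs_le_of_sum (fun k => u k - u' k) H.h0 H.h4 k)
      (abs_le_of_sum (fun k => r * (v k - v' k)) H.h0
        (by simp only [mul_pow]; rw [← Finset.mul_sum]; exact H.h5) k)
      (abs_le_of_sum (fun k => r' * (v k - v' k)) H.h0
        (by simp only [mul_pow]; rw [← Finset.mul_sum]; exact H.h6) k)
      rfl rfl (den_bound hc hc1 hε G ht k) (den_bound hc hc1 hε G' ht' k)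
      (step_bound hc hc1 hε G' ht' k) (ih (Fin.init y))
    simp only [tS]
    refine this.trans (le_of_eq ?_)
    ring

lemma pred_bound {K : ℕ} {ρ c ε r α β r' α' β' : ℝ} {u v u' v' : Fin K → ℝ}
    (hc : 0 < c) (hc1 : c < 1) (hε : ε = c ^ 2 / 100)
    (G : Good_s7 c ε r α β u v) (G' : Good_s7 c ε r' α' β' u' v')
    (H : Close ρ r α β u v r' α' β' u' v') (n : ℕ) (y : Fin n → Fin K) :
    ∑ k, ((u k + r * tS r α β u v n y * v k) - (u' k + r' * tS r' α' β' u' v' n y * v' k)) ^ 2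
      ≤ 249 * (4 / c) ^ 4 * ρ ^ 2 := by
  have ht' := tS_bound hc hc1 hε G' n y
  have he := err_bound hc hc1 hε G G' H n y
  generalize tS r α β u v n y = t at *
  generalize tS r' α' β' u' v' n y = t' at *
  have hT4 : 4 < 4 / c := by rw [lt_div_iff₀ hc]; linarith
  generalize 4 / c = T at *
  have hρ := H.h0
  have hx : |r * t - r' * t'| ≤ 9 * T ^ 2 * ρ := by
    have e : r * t - r' * t' = r * (t - t') + (r - r') * t' := by ring
    rw [e]
    have : |(r - r') * t'| ≤ ρ * T := by rw [abs_mul]; have := H.h1; gcongr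
    have h2 : T * (T * ρ) ≥ 1 * (T * ρ) := by gcongr; linarith
    refine (abs_add_le _ _).trans ?_
    nlinarith
  have hx2 : (r * t - r' * t') ^ 2 ≤ (9 * T ^ 2 * ρ) ^ 2 := sq_le_sq' (abs_le.1 hx).1 (abs_le.1 hx).2
  have ht2 : t' ^ 2 ≤ T ^ 2 := sq_le_sq' (abs_le.1 ht').1 (abs_le.1 ht').2
  calc _ ≤ ∑ k, (3 * (u k - u' k) ^ 2 + 3 * (r * t - r' * t') ^ 2 * (v k) ^ 2
        + 3 * t' ^ 2 * (r' ^ 2 * (v k - v' k) ^ 2)) := by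
        refine Finset.sum_le_sum fun k _ => ?_
        have : (u k + r * t * v k) - (u' k + r' * t' * v' k)
          = (u k - u' k) + (r * t - r' * t') * v k + t' * (r' * (v k - v' k)) := by ring
        rw [this]
        generalize u k - u' k = A
        have h : ∀ B C : ℝ, (A + B + C) ^ 2 ≤ 3 * A ^ 2 + 3 * B ^ 2 + 3 * C ^ 2 := by
          intro B C
          nlinarith [sq_nonneg (A - B), sq_nonneg (A - C), sq_nonneg (B - C)]
        refine (h _ _).trans (le_of_eq (by ring))
    _ = 3 * ∑ k, (u k - u' k) ^ 2 + 3 * (r * t - r' * t') ^ 2 * ∑ k, (v k) ^ 2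
        + 3 * t' ^ 2 * (r' ^ 2 * ∑ k, (v k - v' k) ^ 2) := by
        rw [Finset.sum_add_distrib, Finset.sum_add_distrib]
        simp only [Finset.mul_sum]
    _ ≤ 3 * ρ ^ 2 + 3 * (9 * T ^ 2 * ρ) ^ 2 * 1 + 3 * T ^ 2 * ρ ^ 2 := by
        rw [H.h7]
        have := H.h4; have := H.h6
        gcongr
    _ ≤ _ := by
        have : 1 ≤ T ^ 2 := by nlinarith
        have h2 : T ^ 2 ≤ T ^ 4 := by nlinarith
        have h3 : 1 * ρ ^ 2 ≤ T ^ 4 * ρ ^ 2 := by gcongr; linarith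
        have h4 : T ^ 2 * ρ ^ 2 ≤ T ^ 4 * ρ ^ 2 := by gcongr
        nlinarith

lemma kl_step {K : ℕ} (D D' : Fin K → ℝ) {m : ℝ} (hm : 0 < m) (h : ∀ k, m ≤ D k)
    (h' : ∀ k, m ≤ D' k) (hs : ∑ k, D k = 1) (hs' : ∑ k, D' k = 1) :
    ∑ k, D k * Real.log (D k / D' k) ≤ m⁻¹ * ∑ k, (D k - D' k) ^ 2 := by
  have e : m⁻¹ * ∑ k, (D k - D' k) ^ 2 =
      ∑ k, (m⁻¹ * (D k - D' k) ^ 2 + (D k - D' k)) := by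
    rw [Finset.sum_add_distrib, Finset.sum_sub_distrib, hs, hs', Finset.mul_sum]; ring
  rw [e]
  refine Finset.sum_le_sum fun k _ => ?_
  have hk := h k
  have hk' := h' k
  have p : 0 < D k := by linarith
  have p' : 0 < D' k := by linarith
  calc _ ≤ D k * (D k / D' k - 1) := by
        gcongr; exact Real.log_le_sub_one_of_pos (by positivity)
    _ = (D' k)⁻¹ * (D k - D' k) ^ 2 + (D k - D' k) := by field_simp; ring
    _ ≤ _ := by gcongr

lemma PR_pos {K : ℕ} {c ε r α β : ℝ} {u v : Fin K → ℝ} (hc : 0 < c) (hc1 : c < 1)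
    (hε : ε = c ^ 2 / 100) (G : Good_s7 c ε r α β u v) (n : ℕ) (y : Fin n → Fin K) :
    0 < PR r α β u v n y := by
  induction n with
  | zero => simp [PR]
  | succ n ih =>
    have := den_bound hc hc1 hε G (tS_bound hc hc1 hε G n (Fin.init y)) (y (Fin.last n))
    exact mul_pos (ih _) (by linarith)

lemma pred_sum {K : ℕ} {u v : Fin K → ℝ} (hu : ∑ k, u k = 1) (hv : ∑ k, v k = 0) (x : ℝ) :
    ∑ k, (u k + x * v k) = 1 := by
  rw [Finset.sum_add_distrib, ← Finset.mul_sum, hu, hv]; ring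

lemma PR_snoc {K : ℕ} (r α β : ℝ) (u v : Fin K → ℝ) (n : ℕ) (y : Fin n → Fin K) (k : Fin K) :
    PR r α β u v (n + 1) (Fin.snoc y k : Fin (n + 1) → Fin K) =
      PR r α β u v n y * (u k + r * tS r α β u v n y * v k) := by
  simp only [PR, Fin.snoc_last (α := fun _ => Fin K), Fin.init_snoc (α := fun _ => Fin K)]

lemma PR_sum {K : ℕ} {r α β : ℝ} {u v : Fin K → ℝ} (hu : ∑ k, u k = 1) (hv : ∑ k, v k = 0)
    (n : ℕ) : ∑ y, PR r α β u v n y = 1 := by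
  induction n with
  | zero => simp [PR]
  | succ n ih =>
    rw [sum_snoc_s7]
    simp only [PR_snoc, ← Finset.mul_sum, pred_sum hu hv, mul_one]
    exact ih

lemma kl_PR {K : ℕ} {ρ c ε r α β r' α' β' : ℝ} {u v u' v' : Fin K → ℝ}
    (hc : 0 < c) (hc1 : c < 1) (hε : ε = c ^ 2 / 100)
    (G : Good_s7 c ε r α β u v) (G' : Good_s7 c ε r' α' β' u' v')
    (H : Close ρ r α β u v r' α' β' u' v')
    (hu : ∑ k, u k = 1) (hv : ∑ k, v k = 0) (hu' : ∑ k, u' k = 1) (hv' : ∑ k, v' k = 0) (n : ℕ) :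
    klDiv n (PR r α β u v n) (PR r' α' β' u' v' n)
      ≤ ((c / 2)⁻¹ * (249 * (4 / c) ^ 4)) * n * ρ ^ 2 := by
  induction n with
  | zero => simp [klDiv, PR]
  | succ n ih =>
    set B := ((c / 2)⁻¹ * (249 * (4 / c) ^ 4)) with hB
    have step : ∀ y : Fin n → Fin K, ∑ k, PR r α β u v (n + 1) (Fin.snoc y k : Fin (n + 1) → Fin K)
        * Real.log (PR r α β u v (n + 1) (Fin.snoc y k : Fin (n + 1) → Fin K) /
          PR r' α' β' u' v' (n + 1) (Fin.snoc y k : Fin (n + 1) → Fin K))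
        ≤ PR r α β u v n y * Real.log (PR r α β u v n y / PR r' α' β' u' v' n y)
          + PR r α β u v n y * (B * ρ ^ 2) := by
      intro y
      have hp := PR_pos hc hc1 hε G n y
      have hp' := PR_pos hc hc1 hε G' n y
      have hd := den_bound hc hc1 hε G (tS_bound hc hc1 hε G n y)
      have hd' := den_bound hc hc1 hε G' (tS_bound hc hc1 hε G' n y)
      have hb := pred_bound hc hc1 hε G G' H n y
      have hk := kl_step _ _ (by positivity : 0 < c / 2) hd hd' (pred_sum hu hv _)
        (pred_sum hu' hv' _)
      have hk2 : _ ≤ B * ρ ^ 2 := hk.trans (by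
        rw [hB, mul_assoc]
        exact mul_le_mul_of_nonneg_left hb (by positivity))
      simp only [PR_snoc]
      have e : ∀ k, PR r α β u v n y * (u k + r * tS r α β u v n y * v k) *
          Real.log (PR r α β u v n y * (u k + r * tS r α β u v n y * v k) /
            (PR r' α' β' u' v' n y * (u' k + r' * tS r' α' β' u' v' n y * v' k)))
          = PR r α β u v n y * Real.log (PR r α β u v n y / PR r' α' β' u' v' n y) *
              (u k + r * tS r α β u v n y * v k)
            + PR r α β u v n y * ((u k + r * tS r α β u v n y * v k) *
              Real.log ((u k + r * tS r α β u v n y * v k) /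
                (u' k + r' * tS r' α' β' u' v' n y * v' k))) := by
        intro k
        have a1 := hd k
        have a2 := hd' k
        have a3 : 0 < u k + r * tS r α β u v n y * v k := by linarith
        have a4 : 0 < u' k + r' * tS r' α' β' u' v' n y * v' k := by linarith
        rw [mul_div_mul_comm, Real.log_mul (by positivity) (by positivity)]
        ring
      rw [Finset.sum_congr rfl (fun k _ => e k), Finset.sum_add_distrib, ← Finset.mul_sum,
        ← Finset.mul_sum, pred_sum hu hv, mul_one]
      gcongr
    calc _ = ∑ y : Fin n → Fin K, _ := by unfold klDiv; rw [sum_snoc_s7]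
      _ ≤ _ := Finset.sum_le_sum fun y _ => step y
      _ = klDiv n (PR r α β u v n) (PR r' α' β' u' v' n) + B * ρ ^ 2 := by
        rw [Finset.sum_add_distrib, ← Finset.sum_mul, PR_sum hu hv, one_mul]; rfl
      _ ≤ _ := by push_cast; linarith

lemma sum_of_enorm {K : ℕ} {f : Fin K → ℝ} (h : enormF f = 1) : ∑ k, f k ^ 2 = 1 := by
  unfold enormF at h
  rwa [Real.sqrt_eq_one] at h

lemma sq_enorm {K : ℕ} (f : Fin K → ℝ) : ∑ k, f k ^ 2 = enormF f ^ 2 := by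
  unfold enormF
  rw [Real.sq_sqrt (Finset.sum_nonneg fun _ _ => sq_nonneg _)]

lemma good_of {K : ℕ} {c : ℝ} (hc : 0 < c) (hc1 : c < 1) (π : PP K) (s : ℝ)
    (hs : s = 1 ∨ s = -1) (hd : IsDensity π.2.1) (hn : enormF π.2.2 = 1) (hz : ∑ k, π.2.2 k = 0)
    (h1 : |π.1.1| ≤ 1) (h3 : 0 ≤ π.1.2.2)
    (hf0 : ∀ k, c ≤ (unpack π).f0 k) (hf1 : ∀ k, c ≤ (unpack π).f1 k)
    (he : |π.1.2.1| ≤ c ^ 2 / 100) :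
    Good_s7 c (c ^ 2 / 100) (rfun π.1) π.1.2.1 (s * (π.1.1 * π.1.2.1 * π.1.2.2)) π.2.1
      (fun k => s * π.2.2 k) := by
  have hs1 : |s| = 1 := by rcases hs with h | h <;> simp [h]
  have hn2 := sum_of_enorm hn
  have s0 : ∑ k, (unpack π).f0 k = 1 := by
    simp only [unpack]
    have : ∀ k, π.2.1 k - π.1.1 * π.1.2.2 * π.2.2 k / 2 + π.1.2.2 * π.2.2 k / 2
      = π.2.1 k + (- π.1.1 * π.1.2.2 / 2 + π.1.2.2 / 2) * π.2.2 k := by intro k; ring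
    simp only [this]
    exact pred_sum hd.2 hz _
  have s1 : ∑ k, (unpack π).f1 k = 1 := by
    simp only [unpack]
    have : ∀ k, π.2.1 k - π.1.1 * π.1.2.2 * π.2.2 k / 2 - π.1.2.2 * π.2.2 k / 2
      = π.2.1 k + (- π.1.1 * π.1.2.2 / 2 - π.1.2.2 / 2) * π.2.2 k := by intro k; ring
    simp only [this]
    exact pred_sum hd.2 hz _
  have le1 : ∀ f : Fin K → ℝ, (∀ k, 0 ≤ f k) → ∑ k, f k = 1 → ∀ k, f k ≤ 1 := by
    intro f h hs k
    rw [← hs]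
    exact Finset.single_le_sum (fun k _ => h k) (Finset.mem_univ k)
  have b0 := le1 _ (fun k => hc.le.trans (hf0 k)) s0
  have b1 := le1 _ (fun k => hc.le.trans (hf1 k)) s1
  have hφ : π.1.2.2 ^ 2 ≤ 2 := by
    have e : π.1.2.2 ^ 2 = ∑ k, ((unpack π).f0 k - (unpack π).f1 k) ^ 2 := by
      have : ∀ k, ((unpack π).f0 k - (unpack π).f1 k) ^ 2 = π.1.2.2 ^ 2 * π.2.2 k ^ 2 := by
        intro k; simp only [unpack]; ring
      simp only [this]
      rw [← Finset.mul_sum, hn2, mul_one]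
    rw [e]
    calc _ ≤ ∑ k, ((unpack π).f0 k + (unpack π).f1 k) := by
          refine Finset.sum_le_sum fun k _ => ?_
          nlinarith [b0 k, b1 k, hf0 k, hf1 k, mul_nonneg (hc.le.trans (hf0 k)) (hc.le.trans (hf1 k)),
            mul_nonneg (hc.le.trans (hf0 k)) (sub_nonneg.2 (b0 k)),
            mul_nonneg (hc.le.trans (hf1 k)) (sub_nonneg.2 (b1 k))]
      _ = 2 := by rw [Finset.sum_add_distrib, s0, s1]; norm_num
  have hφ2 : π.1.2.2 ≤ 2 := by nlinarith
  constructor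
  · unfold rfun
    have h11 : π.1.1 ^ 2 ≤ 1 := (sq_le_one_iff_abs_le_one _).2 h1
    have : |1 - π.1.1 ^ 2| ≤ 1 := abs_le.2 ⟨by linarith, by nlinarith [sq_nonneg π.1.1]⟩
    rw [abs_div, abs_mul, abs_mul, abs_of_nonneg (sq_nonneg π.1.2.2)]
    calc _ ≤ 1 * (c ^ 2 / 100) * 2 / |(4 : ℝ)| := by gcongr
      _ = _ := by norm_num; ring
  · exact he
  · rw [abs_mul, abs_mul, abs_mul, hs1, abs_of_nonneg h3]
    calc _ ≤ 1 * (1 * (c ^ 2 / 100) * 2) := by gcongr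
      _ = _ := by ring
  · intro k
    have e : π.2.1 k = (1 + π.1.1) / 2 * (unpack π).f0 k + (1 - π.1.1) / 2 * (unpack π).f1 k := by
      simp only [unpack]; ring
    rw [e]
    have := abs_le.1 h1
    nlinarith [mul_nonneg (by linarith : 0 ≤ (1 + π.1.1) / 2) (sub_nonneg.2 (hf0 k)),
      mul_nonneg (by linarith : 0 ≤ (1 - π.1.1) / 2) (sub_nonneg.2 (hf1 k))]
  · exact le1 _ hd.1 hd.2
  · intro k
    rw [abs_mul, hs1, one_mul]
    exact abs_le_of_sum π.2.2 zero_le_one (by rw [hn2]; norm_num) k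

lemma sgn_cases (t : ℝ) : sgn t = 1 ∨ sgn t = -1 := by
  unfold sgn; split_ifs <;> simp

lemma close_of {K : ℕ} (π π' : PP K) (hn : enormF π.2.2 = 1) :
    Close (rho π π') (rfun π.1) π.1.2.1 (1 * (π.1.1 * π.1.2.1 * π.1.2.2)) π.2.1
      (fun k => 1 * π.2.2 k)
      (rfun π'.1) π'.1.2.1
      (sgn (∑ k, π.2.2 k * π'.2.2 k) * (π'.1.1 * π'.1.2.1 * π'.1.2.2)) π'.2.1
      (fun k => sgn (∑ k, π.2.2 k * π'.2.2 k) * π'.2.2 k) := by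
  set s := sgn (∑ k, π.2.2 k * π'.2.2 k) with hs
  have c1 : |(mvec π.1).1 - (mvec π'.1).1| ≤ rho π π' := by
    unfold rho; simp only [le_max_iff, le_refl, true_or]
  have c2 : |(mvec π.1).2.1 - (mvec π'.1).2.1| ≤ rho π π' := by
    unfold rho; simp only [le_max_iff, le_refl, true_or, or_true]
  have c3 : |(mvec π.1).2.2 - s * (mvec π'.1).2.2| ≤ rho π π' := by
    unfold rho; simp only [le_max_iff, hs, le_refl, true_or, or_true]
  have c4 : (enormF fun k => π.2.1 k - π'.2.1 k) ≤ rho π π' := by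
    unfold rho; simp only [le_max_iff, le_refl, true_or, or_true]
  have c5 : (max |(mvec π.1).1| |(mvec π'.1).1|) *
      (enormF fun k => π.2.2 k - s * π'.2.2 k) ≤ rho π π' := by
    unfold rho; exact le_max_right _ _
  have h0 : 0 ≤ rho π π' := (abs_nonneg _).trans c1
  have en : ∀ f : Fin K → ℝ, 0 ≤ enormF f := fun f => Real.sqrt_nonneg _
  have c6 : |rfun π.1| * (enormF fun k => π.2.2 k - s * π'.2.2 k) ≤ rho π π' :=
    le_trans (mul_le_mul_of_nonneg_right (le_max_left _ _) (en _)) c5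
  have c7 : |rfun π'.1| * (enormF fun k => π.2.2 k - s * π'.2.2 k) ≤ rho π π' :=
    le_trans (mul_le_mul_of_nonneg_right (le_max_right _ _) (en _)) c5
  simp only [mvec] at c1 c2 c3
  refine ⟨h0, c1, ?_, ?_, ?_, ?_, ?_, ?_⟩
  · rwa [mul_comm (rfun π.1), mul_comm (rfun π'.1)]
  · convert c3 using 2; ring
  · rw [sq_enorm (fun k => π.2.1 k - π'.2.1 k)]
    exact pow_le_pow_left₀ (en _) c4 2
  · simp only [one_mul]
    rw [sq_enorm (fun k => π.2.2 k - s * π'.2.2 k), ← sq_abs (rfun _), ← mul_pow]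
    exact pow_le_pow_left₀ (mul_nonneg (abs_nonneg _) (en _)) c6 2
  · simp only [one_mul]
    rw [sq_enorm (fun k => π.2.2 k - s * π'.2.2 k), ← sq_abs (rfun _), ← mul_pow]
    exact pow_le_pow_left₀ (mul_nonneg (abs_nonneg _) (en _)) c7 2
  · simp only [one_mul]; exact sum_of_enorm hn

theorem statement7 (c : ℝ) (hc : c ∈ Set.Ioo (0 : ℝ) 1) :
    ∃ C ε₀ : ℝ, 0 < C ∧ 0 < ε₀ ∧
      ∀ (K : ℕ), 2 ≤ K →
      ∀ π π' : PP K,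
        IsDensity π.2.1 → enormF π.2.2 = 1 → ∑ k, π.2.2 k = 0 →
        |π.1.1| ≤ 1 → |π.1.2.1| ≤ 1 → 0 ≤ π.1.2.2 →
        IsDensity π'.2.1 → enormF π'.2.2 = 1 → ∑ k, π'.2.2 k = 0 →
        |π'.1.1| ≤ 1 → |π'.1.2.1| ≤ 1 → 0 ≤ π'.1.2.2 →
        (∀ k, c ≤ (unpack π).f0 k) → (∀ k, c ≤ (unpack π).f1 k) →
        (∀ k, c ≤ (unpack π').f0 k) → (∀ k, c ≤ (unpack π').f1 k) →
        max |π.1.2.1| |π'.1.2.1| ≤ ε₀ →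
        ∀ n : ℕ,
          klDiv n (pLaw (unpack π) n) (pLaw (unpack π') n)
            ≤ C * n * (rho π π') ^ 2 := by
  obtain ⟨hc0, hc1⟩ := hc
  refine ⟨(c / 2)⁻¹ * (249 * (4 / c) ^ 4), c ^ 2 / 100, by positivity, by positivity, ?_⟩
  intro K _ π π' hd hn hz h1 _ h3 hd' hn' hz' h1' _ h3' f0 f1 f0' f1' hm n
  have he := (le_max_left _ _).trans hm
  have he' := (le_max_right _ _).trans hm
  have hs := sgn_cases (∑ k, π.2.2 k * π'.2.2 k)
  have H := close_of π π' hn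
  set s := sgn (∑ k, π.2.2 k * π'.2.2 k)
  have G := good_of hc0 hc1 π 1 (Or.inl rfl) hd hn hz h1 h3 f0 f1 he
  have G' := good_of hc0 hc1 π' s hs hd' hn' hz' h1' h3' f0' f1' he'
  have lt1 : c ^ 2 / 100 < 1 := by nlinarith
  have e := funext (pLaw_eq_PR π 1 (Or.inl rfl)
    (fun h => by rw [h, abs_one] at he; linarith)
    (fun n y k => by
      have := den_bound hc0 hc1 rfl G (tS_bound hc0 hc1 rfl G n y) k
      exact ne_of_gt (lt_of_lt_of_le (by positivity) this)) n)
  have e' := funext (pLaw_eq_PR π' s hs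
    (fun h => by rw [h, abs_one] at he'; linarith)
    (fun n y k => by
      have := den_bound hc0 hc1 rfl G' (tS_bound hc0 hc1 rfl G' n y) k
      exact ne_of_gt (lt_of_lt_of_le (by positivity) this)) n)
  rw [e, e']
  exact kl_PR hc0 hc1 rfl G G' H hd.2 (by rw [← Finset.mul_sum, hz, mul_zero]) hd'.2
    (by rw [← Finset.mul_sum, hz', mul_zero]) n

end PaperHMM
end
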